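/- arXiv:math/0608274 — 2 statements merged into one kernel-verified Lean document; each statement's English description precedes it below -/
import Mathlib

section
/- For every integer n ≥ 1, the identity Σ_{σ∈S_n} q^{aid(σ)} t^{des(σ)} = Σ_{σ∈S_n} q^{maj(σ)} t^{exc(σ)} holds in ℤ[q,t]. -/
/-!
STATEMENT 2: For every integer n ≥ 1, in ℤ[q,t] (with q = X 0, t = X 1):
Σ_{σ∈S_n} q^{aid σ} t^{des σ} = Σ_{σ∈S_n} q^{maj σ} t^{exc σ},
where aid(σ) = ai(σ) + des(σ) and ai(σ) counts admissible inversions.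
-/

/-- The one-line value `σ(i)` of a permutation of `[n] = {1,…,n}` (1-based), extended
to all of `ℕ` by the identity outside `[n]`. -/
def pv {n : ℕ} (σ : Equiv.Perm (Fin n)) (i : ℕ) : ℕ :=
  if h : 1 ≤ i ∧ i ≤ n then ((σ ⟨i - 1, by omega⟩ : Fin n) : ℕ) + 1 else i

/-- The descent set `Des(σ) = {i ∈ [n-1] : σ(i) > σ(i+1)}`. -/
def DesSet {n : ℕ} (σ : Equiv.Perm (Fin n)) : Finset ℕ :=
  (Finset.Icc 1 (n - 1)).filter fun i => pv σ (i + 1) < pv σ i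

/-- The descent number `des(σ) = |Des(σ)|`. -/
def desStat {n : ℕ} (σ : Equiv.Perm (Fin n)) : ℕ := (DesSet σ).card

/-- The major index `maj(σ) = Σ_{i ∈ Des(σ)} i`. -/
def maj {n : ℕ} (σ : Equiv.Perm (Fin n)) : ℕ := ∑ i ∈ DesSet σ, i

/-- The excedance set `Exc(σ) = {i ∈ [n-1] : σ(i) > i}`. -/
def ExcSet {n : ℕ} (σ : Equiv.Perm (Fin n)) : Finset ℕ :=
  (Finset.Icc 1 (n - 1)).filter fun i => i < pv σ i

/-- The excedance number `exc(σ) = |Exc(σ)|`. -/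
def exc {n : ℕ} (σ : Equiv.Perm (Fin n)) : ℕ := (ExcSet σ).card

/-- The number of admissible inversions of `σ`: pairs of positions `(i,j)` with
`1 ≤ i < j ≤ n`, `σ(i) > σ(j)`, and either (`j < n` and `σ(j) < σ(j+1)`) or there is
some `k` with `i < k < j` and `σ(k) < σ(j)`. -/
def aiStat {n : ℕ} (σ : Equiv.Perm (Fin n)) : ℕ :=
  (((Finset.Icc 1 n) ×ˢ (Finset.Icc 1 n)).filter fun p =>
    p.1 < p.2 ∧ pv σ p.2 < pv σ p.1 ∧
      ((p.2 < n ∧ pv σ p.2 < pv σ (p.2 + 1)) ∨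
        ∃ k ∈ Finset.Ioo p.1 p.2, pv σ k < pv σ p.2)).card

/-- `aid(σ) = ai(σ) + des(σ)`. -/
def aid {n : ℕ} (σ : Equiv.Perm (Fin n)) : ℕ := aiStat σ + desStat σ

/-- The number of admissible inversions that a letter `x` forms with the entries of a word to its
right, where `k` bounds from above the entries already read. -/
def admCount (x : ℕ) : ℕ → List ℕ → ℕ
  | _, [] => 0
  | k, y :: l => (if y < x ∧ (y < l.headD 0 ∨ k < y) then 1 else 0) + admCount x (min k y) l

/-- The number of admissible inversions of a word. -/
def listAi : List ℕ → ℕ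
  | [] => 0
  | x :: l => admCount x x l + listAi l

/-- The number of descents of a word. -/
def listDes : List ℕ → ℕ
  | [] => 0
  | x :: l => (if l.headD x < x then 1 else 0) + listDes l

lemma admCount_eq_countP {x k : ℕ} {l : List ℕ} (h : ∀ b ∈ l, k < b) :
    admCount x k l = l.countP (· < x) := by
  induction l with
  | nil => rfl
  | cons y l ih =>
    have hy : k < y := h y (by simp)
    rw [admCount, min_eq_left hy.le, ih fun b hb => h b (by simp [hb]), List.countP_cons]
    simp [hy, add_comm]

lemma admCount_append_cons {x m : ℕ} {α β : List ℕ} (hα : ∀ a ∈ α, m < a) (hβ : ∀ b ∈ β, m < b)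
    (hx : m < x) (hne : β ≠ []) (k : ℕ) (hk : m ≤ k) :
    admCount x k (α ++ m :: β) = admCount x k α + 1 + β.countP (· < x) := by
  induction α generalizing k with
  | nil =>
    obtain ⟨b, β', rfl⟩ := List.exists_cons_of_ne_nil hne
    have := hβ b (by simp)
    rw [List.nil_append, admCount.eq_2, min_eq_right hk, admCount_eq_countP hβ]
    simp [hx, this, admCount]
  | cons y α ih =>
    have hy : m < y := hα y (by simp)
    have ih' := ih (fun a ha => hα a (by simp [ha])) (min k y) (le_min hk hy.le)
    rw [List.cons_append, admCount, admCount, ih']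
    cases α with
    | nil => simp [hy.not_gt]; ring
    | cons z α => simp; ring

lemma admCount_append_singleton {x m : ℕ} {α : List ℕ} (hα : ∀ a ∈ α, m < a) (k : ℕ)
    (hk : m ≤ k) : admCount x k (α ++ [m]) = admCount x k α := by
  induction α generalizing k with
  | nil => simp [admCount, hk.not_gt]
  | cons y α ih =>
    have hy : m < y := hα y (by simp)
    have ih' := ih (fun a ha => hα a (by simp [ha])) (min k y) (le_min hk hy.le)
    rw [List.cons_append, admCount, admCount, ih']
    cases α with
    | nil => simp [hy.not_gt]
    | cons z α => simp

lemma listAi_append_cons {m : ℕ} {α β : List ℕ} (hα : ∀ a ∈ α, m < a) (hβ : ∀ b ∈ β, m < b)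
    (hne : β ≠ []) :
    listAi (α ++ m :: β) =
      listAi α + listAi β + (α.length + (α.map fun x => β.countP (· < x)).sum) := by
  induction α with
  | nil =>
    have : β.countP (· < m) = 0 := by
      rw [List.countP_eq_zero]
      intro b hb
      simpa using (hβ b hb).le
    simp [listAi, admCount_eq_countP hβ, this]
  | cons x α ih =>
    have hx : m < x := hα x (by simp)
    have hα' : ∀ a ∈ α, m < a := fun a ha => hα a (by simp [ha])
    rw [List.cons_append, listAi, listAi, ih hα', admCount_append_cons hα' hβ hx hne x hx.le]
    simp
    ring

lemma listAi_append_singleton {m : ℕ} {α : List ℕ} (hα : ∀ a ∈ α, m < a) :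
    listAi (α ++ [m]) = listAi α := by
  induction α with
  | nil => rfl
  | cons x α ih =>
    have hx : m < x := hα x (by simp)
    have hα' : ∀ a ∈ α, m < a := fun a ha => hα a (by simp [ha])
    rw [List.cons_append, listAi, listAi, ih hα', admCount_append_singleton hα' x hx.le]

lemma listDes_cons_of_lt {m : ℕ} {β : List ℕ} (hβ : ∀ b ∈ β, m < b) :
    listDes (m :: β) = listDes β := by
  cases β with
  | nil => simp [listDes]
  | cons b β => simp [listDes, (hβ b (by simp)).not_gt]

lemma listDes_append_cons {m : ℕ} {α β : List ℕ} (hα : ∀ a ∈ α, m < a) (hβ : ∀ b ∈ β, m < b)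
    (hne : α ≠ []) : listDes (α ++ m :: β) = listDes α + listDes β + 1 := by
  induction α with
  | nil => exact absurd rfl hne
  | cons x α ih =>
    have hx : m < x := hα x (by simp)
    rw [List.cons_append, listDes, listDes]
    cases α with
    | nil => simp [listDes_cons_of_lt hβ, hx, listDes]; ring
    | cons y α =>
      rw [ih (fun a ha => hα a (by simp [ha])) (by simp)]
      simp
      ring

/-- The words in which each element of `V` occurs exactly once. -/
noncomputable def orderings (V : Finset ℕ) : Finset (List ℕ) := V.toList.permutations.toFinset

lemma mem_orderings {V : Finset ℕ} {l : List ℕ} :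
    l ∈ orderings V ↔ l.Nodup ∧ l.toFinset = V := by
  rw [orderings, List.mem_toFinset, List.mem_permutations]
  constructor
  · intro h
    exact ⟨h.nodup_iff.2 V.nodup_toList, by rw [List.toFinset_eq_of_perm _ _ h, V.toList_toFinset]⟩
  · rintro ⟨h, rfl⟩
    exact (List.toFinset_toList h).symm

lemma mem_of_mem_orderings {V : Finset ℕ} {l : List ℕ} (h : l ∈ orderings V) {x : ℕ} :
    x ∈ l ↔ x ∈ V := by
  rw [← (mem_orderings.1 h).2, List.mem_toFinset]

lemma orderings_empty : orderings ∅ = {[]} := by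
  simp [orderings]

lemma sum_orderings_insert {R : Type*} [AddCommMonoid R] {V : Finset ℕ} {m : ℕ} (hm : m ∉ V)
    (F : List ℕ → R) :
    ∑ l ∈ orderings (insert m V), F l =
      ∑ A ∈ V.powerset, ∑ α ∈ orderings A, ∑ β ∈ orderings (V \ A), F (α ++ m :: β) := by
  simp_rw [← Finset.sum_product']
  rw [Finset.sum_sigma']
  symm
  refine Finset.sum_nbij (fun p => p.2.1 ++ m :: p.2.2) ?_ ?_ ?_ fun _ _ => rfl
  · rintro ⟨A, α, β⟩ h
    simp only [Finset.mem_sigma, Finset.mem_powerset, Finset.mem_product, mem_orderings] at h ⊢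
    obtain ⟨hA, ⟨hα, rfl⟩, hβ, hβ'⟩ := h
    have hmα : m ∉ α := fun h => hm (hA (by simpa using h))
    have hb : ∀ b, b ∈ β ↔ b ∈ V ∧ b ∉ α := by
      intro b
      rw [← List.mem_toFinset, hβ']
      simp
    constructor
    · rw [List.nodup_append]
      refine ⟨hα, List.nodup_cons.2 ⟨fun h => hm ((hb m).1 h).1, hβ⟩, ?_⟩
      rintro a ha b hb' rfl
      rcases List.mem_cons.1 hb' with rfl | h
      · exact hmα ha
      · exact ((hb _).1 h).2 ha
    · ext b
      have := @hA b
      simp only [List.mem_toFinset] at this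
      simp only [List.mem_toFinset, List.mem_append, List.mem_cons, hb, Finset.mem_insert]
      tauto
  · rintro ⟨A, α, β⟩ h ⟨A', α', β'⟩ h' he
    simp only [Finset.coe_sigma, Set.mem_sigma_iff, Finset.mem_coe, Finset.mem_powerset,
      Finset.mem_product] at h h'
    obtain ⟨hA, hα, hβ⟩ := h
    obtain ⟨hA', hα', hβ'⟩ := h'
    have h1 : m ∉ α := fun h => hm (hA ((mem_of_mem_orderings hα).1 h))
    have h2 : m ∉ β := fun h => hm (Finset.mem_sdiff.1 ((mem_of_mem_orderings hβ).1 h)).1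
    obtain ⟨rfl, -, rfl⟩ := (List.append_cons_inj_of_notMem h1 h2).1 he
    obtain rfl : A = A' := by rw [← (mem_orderings.1 hα).2, ← (mem_orderings.1 hα').2]
    rfl
  · intro l hl
    rw [Finset.mem_coe, mem_orderings] at hl
    obtain ⟨hl, hV⟩ := hl
    have hml : m ∈ l := by rw [← List.mem_toFinset, hV]; simp
    obtain ⟨α, β, rfl⟩ := List.append_of_mem hml
    have hV' : ∀ b, (b ∈ α ∨ b = m ∨ b ∈ β) ↔ (b = m ∨ b ∈ V) := by
      intro b
      rw [← Finset.mem_insert, ← hV]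
      simp only [List.mem_toFinset, List.mem_append, List.mem_cons]
    rw [List.nodup_append, List.nodup_cons] at hl
    obtain ⟨hα, ⟨hmβ, hβ⟩, hd⟩ := hl
    have hmα : m ∉ α := fun h => hd m h m (by simp) rfl
    have hαV : ∀ a ∈ α, a ∈ V := by
      intro a ha
      rcases (hV' a).1 (Or.inl ha) with rfl | h
      · exact absurd ha hmα
      · exact h
    refine ⟨⟨α.toFinset, α, β⟩, ?_, rfl⟩
    simp only [Finset.coe_sigma, Set.mem_sigma_iff, Finset.mem_coe, Finset.mem_powerset,
      Finset.mem_product, mem_orderings]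
    refine ⟨fun a ha => hαV a (by simpa using ha), ⟨hα, trivial⟩, hβ, ?_⟩
    ext b
    have h1 := hV' b
    have h2 : b ∈ α → b ∉ β := fun h h' => hd b h b (by simp [h']) rfl
    have h3 : b ∈ β → b ≠ m := by rintro h rfl; exact hmβ h
    have h4 : b ∈ V → b ≠ m := by rintro h rfl; exact hm h
    simp only [List.mem_toFinset, Finset.mem_sdiff]
    tauto

/-- The product `(r - 1) (r² - 1) ⋯ (rⁿ - 1)`. -/
def powSubOneProd (r : ℝ) (n : ℕ) : ℝ := ∏ k ∈ Finset.range n, (r ^ (k + 1) - 1)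

lemma powSubOneProd_succ (r : ℝ) (n : ℕ) :
    powSubOneProd r (n + 1) = powSubOneProd r n * (r ^ (n + 1) - 1) :=
  Finset.prod_range_succ _ _

lemma powSubOneProd_ne_zero {r : ℝ} (hr : 1 < r) (n : ℕ) : powSubOneProd r n ≠ 0 :=
  Finset.prod_ne_zero_iff.2 fun k _ => (sub_pos.2 (one_lt_pow₀ hr k.succ_ne_zero)).ne'

lemma sum_powerset_pow_inv {r : ℝ} (hr : 1 < r) (V : Finset ℕ) (g : ℕ → ℕ → ℝ) :
    ∑ A ∈ V.powerset, r ^ (∑ x ∈ A, ((V \ A).filter (· < x)).card) * g A.card (V \ A).card =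
      ∑ p ∈ Finset.HasAntidiagonal.antidiagonal V.card,
        powSubOneProd r V.card / (powSubOneProd r p.1 * powSubOneProd r p.2) * g p.1 p.2 := by
  induction V using Finset.induction_on_max generalizing g with
  | empty => simp [powSubOneProd]
  | insert v V hv ih =>
    have hvV : v ∉ V := fun h => (hv v h).false
    have h1 : ∀ A ∈ V.powerset,
        r ^ (∑ x ∈ A, ((insert v V \ A).filter (· < x)).card) * g A.card (insert v V \ A).card =
        r ^ (∑ x ∈ A, ((V \ A).filter (· < x)).card) * g A.card ((V \ A).card + 1) := by
      intro A hA
      rw [Finset.mem_powerset] at hA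
      have hvA : v ∉ A := fun h => hvV (hA h)
      rw [Finset.insert_sdiff_of_notMem _ hvA, Finset.card_insert_of_notMem (by simp [hvV])]
      congr 2
      refine Finset.sum_congr rfl fun x hx => ?_
      rw [Finset.filter_insert, if_neg (hv x (hA hx)).not_gt]
    have h2 : ∀ A ∈ V.powerset,
        r ^ (∑ x ∈ insert v A, ((insert v V \ insert v A).filter (· < x)).card) *
          g (insert v A).card (insert v V \ insert v A).card =
        r ^ (∑ x ∈ A, ((V \ A).filter (· < x)).card) *
          (r ^ (V \ A).card * g (A.card + 1) (V \ A).card) := by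
      intro A hA
      rw [Finset.mem_powerset] at hA
      have hvA : v ∉ A := fun h => hvV (hA h)
      have he : insert v V \ insert v A = V \ A := by
        ext b
        simp only [Finset.mem_sdiff, Finset.mem_insert]
        have : b ∈ V → b ≠ v := by rintro h rfl; exact hvV h
        tauto
      rw [he, Finset.sum_insert hvA, Finset.card_insert_of_notMem hvA,
        Finset.filter_true_of_mem fun y hy => hv y (Finset.mem_sdiff.1 hy).1, pow_add]
      ring
    rw [Finset.sum_powerset_insert hvV, Finset.sum_congr rfl h1, Finset.sum_congr rfl h2,
      ih fun a b => g a (b + 1), ih fun a b => r ^ b * g (a + 1) b,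
      Finset.card_insert_of_notMem hvV]
    set n := V.card
    have h3 : ∀ p ∈ Finset.HasAntidiagonal.antidiagonal (n + 1),
        powSubOneProd r (n + 1) / (powSubOneProd r p.1 * powSubOneProd r p.2) * g p.1 p.2 =
        powSubOneProd r n * (r ^ p.2 * (r ^ p.1 - 1)) /
            (powSubOneProd r p.1 * powSubOneProd r p.2) * g p.1 p.2 +
          powSubOneProd r n * (r ^ p.2 - 1) /
            (powSubOneProd r p.1 * powSubOneProd r p.2) * g p.1 p.2 := by
      intro p hp
      rw [Finset.HasAntidiagonal.mem_antidiagonal] at hp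
      rw [powSubOneProd_succ, ← hp, pow_add]
      ring
    rw [Finset.sum_congr rfl h3, Finset.sum_add_distrib, Finset.Nat.sum_antidiagonal_succ,
      Finset.Nat.sum_antidiagonal_succ', add_comm]
    simp only [pow_zero, sub_self, mul_zero, zero_div, zero_mul, zero_add]
    congr 1
    · refine Finset.sum_congr rfl fun p _ => ?_
      have ha := powSubOneProd_ne_zero hr (p.1 + 1)
      rw [powSubOneProd_succ] at ha ⊢
      have := left_ne_zero_of_mul ha
      have := right_ne_zero_of_mul ha
      have := powSubOneProd_ne_zero hr p.2
      field_simp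
    · refine Finset.sum_congr rfl fun p _ => ?_
      have ha := powSubOneProd_ne_zero hr (p.2 + 1)
      rw [powSubOneProd_succ] at ha ⊢
      have := left_ne_zero_of_mul ha
      have := right_ne_zero_of_mul ha
      have := powSubOneProd_ne_zero hr p.1
      field_simp

lemma sum_map_countP_lt {A B : Finset ℕ} {α β : List ℕ} (hα : α ∈ orderings A)
    (hβ : β ∈ orderings B) :
    (α.map fun x => β.countP (· < x)).sum = ∑ x ∈ A, (B.filter (· < x)).card := by
  rw [mem_orderings] at hα hβ
  rw [← hα.2, List.sum_toFinset _ hα.1, ← hβ.2]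
  congr 1
  refine List.map_congr_left fun x _ => ?_
  rw [List.countP_eq_length_filter, ← List.toFinset_card_of_nodup (hβ.1.filter _),
    List.toFinset_filter]
  simp

lemma length_of_mem_orderings {A : Finset ℕ} {α : List ℕ} (hα : α ∈ orderings A) :
    α.length = A.card := by
  rw [mem_orderings] at hα
  rw [← hα.2, List.toFinset_card_of_nodup hα.1]

lemma eq_nil_of_mem_orderings_iff {A : Finset ℕ} {α : List ℕ} (hα : α ∈ orderings A) :
    α = [] ↔ A = ∅ := by
  rw [← List.length_eq_zero_iff, length_of_mem_orderings hα, Finset.card_eq_zero]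

lemma sum_orderings_pow {r t : ℝ} (hr : 1 < r) {h : ℕ → ℝ} (h0 : h 0 = 1)
    (hsucc : ∀ n, h (n + 1) * (r ^ (n + 1) - 1) = h n + t *
      ∑ p ∈ Finset.HasAntidiagonal.antidiagonal n, if p.2 = 0 then 0 else r ^ p.1 * h p.1 * h p.2)
    (V : Finset ℕ) :
    ∑ l ∈ orderings V, r ^ listAi l * t ^ listDes l = powSubOneProd r V.card * h V.card := by
  induction hn : V.card using Nat.strong_induction_on generalizing V with
  | _ n ih =>
    obtain rfl | hV := V.eq_empty_or_nonempty
    · obtain rfl : n = 0 := by simpa using hn.symm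
      simp [orderings_empty, listAi, listDes, powSubOneProd, h0]
    obtain ⟨m, W, hmW, hW, rfl⟩ : ∃ m W, m ∉ W ∧ (∀ a ∈ W, m < a) ∧ V = insert m W :=
      ⟨V.min' hV, V.erase (V.min' hV), by simp, fun a ha => Finset.min'_lt_of_mem_erase_min' _ _ ha,
        (Finset.insert_erase (V.min'_mem hV)).symm⟩
    rw [Finset.card_insert_of_notMem hmW] at hn
    subst hn
    set P := powSubOneProd r
    have hP : ∀ n, P n ≠ 0 := powSubOneProd_ne_zero hr
    let g : ℕ → ℕ → ℝ := fun a b =>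
      if a = 0 then P b * h b else if b = 0 then t * (P a * h a)
        else t * r ^ a * ((P a * h a) * (P b * h b))
    have key : ∀ A ∈ W.powerset,
        ∑ α ∈ orderings A, ∑ β ∈ orderings (W \ A),
          r ^ listAi (α ++ m :: β) * t ^ listDes (α ++ m :: β) =
        r ^ (∑ x ∈ A, ((W \ A).filter (· < x)).card) * g A.card (W \ A).card := by
      intro A hA
      rw [Finset.mem_powerset] at hA
      have hltA : ∀ α ∈ orderings A, ∀ a ∈ α, m < a := fun α hα a ha =>
        hW a (hA ((mem_of_mem_orderings hα).1 ha))
      have hltB : ∀ β ∈ orderings (W \ A), ∀ b ∈ β, m < b := fun β hβ b hb =>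
        hW b (Finset.mem_sdiff.1 ((mem_of_mem_orderings hβ).1 hb)).1
      have hSA := ih A.card (Nat.lt_succ_of_le (Finset.card_le_card hA)) A rfl
      have hSB := ih (W \ A).card (Nat.lt_succ_of_le (Finset.card_le_card Finset.sdiff_subset))
        (W \ A) rfl
      by_cases hA0 : A = ∅
      · subst hA0
        rw [orderings_empty, Finset.sum_singleton]
        simp only [Finset.sum_empty, pow_zero, one_mul, Finset.card_empty, g, if_true]
        rw [← hSB]
        refine Finset.sum_congr rfl fun β hβ => ?_
        rw [List.nil_append, listDes_cons_of_lt (hltB β hβ)]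
        obtain rfl | hne := eq_or_ne β []
        · simp [listAi, admCount]
        · have := listAi_append_cons (α := []) (by simp) (hltB β hβ) hne
          simp only [List.nil_append] at this
          simp [this, listAi.eq_1]
      by_cases hB0 : W \ A = ∅
      · rw [hB0, orderings_empty]
        simp only [Finset.sum_singleton, Finset.filter_empty, Finset.card_empty,
          Finset.sum_const_zero, pow_zero, one_mul, g, if_true,
          if_neg (mt Finset.card_eq_zero.1 hA0)]
        rw [← hSA, Finset.mul_sum]
        refine Finset.sum_congr rfl fun α hα => ?_
        rw [listAi_append_singleton (hltA α hα), listDes_append_cons (hltA α hα) (by simp)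
          (mt (eq_nil_of_mem_orderings_iff hα).1 hA0)]
        simp [listDes, pow_succ]
        ring
      · simp only [g, if_neg (mt Finset.card_eq_zero.1 hA0),
          if_neg (mt Finset.card_eq_zero.1 hB0)]
        rw [← hSA, ← hSB, Finset.sum_mul_sum, Finset.mul_sum, Finset.mul_sum]
        refine Finset.sum_congr rfl fun α hα => ?_
        rw [Finset.mul_sum, Finset.mul_sum]
        refine Finset.sum_congr rfl fun β hβ => ?_
        rw [listAi_append_cons (hltA α hα) (hltB β hβ)
            (mt (eq_nil_of_mem_orderings_iff hβ).1 hB0),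
          listDes_append_cons (hltA α hα) (hltB β hβ)
            (mt (eq_nil_of_mem_orderings_iff hα).1 hA0),
          sum_map_countP_lt hα hβ, length_of_mem_orderings hα]
        simp only [pow_add]
        ring
    rw [sum_orderings_insert hmW, Finset.sum_congr rfl key, sum_powerset_pow_inv hr]
    generalize W.card = n
    rw [show P (n + 1) = P n * (r ^ (n + 1) - 1) from powSubOneProd_succ r n,
      mul_assoc, mul_comm _ (h (n + 1)), hsucc,
      Finset.Nat.sum_antidiagonal_eq_sum_range_succ_mk,
      Finset.Nat.sum_antidiagonal_eq_sum_range_succ_mk]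
    simp only [g, show powSubOneProd r = P from rfl]
    cases n with
    | zero => simp [P, powSubOneProd, h0]
    | succ k =>
      rw [Finset.sum_range_succ, Finset.sum_range_succ', Finset.sum_range_succ,
        Finset.sum_range_succ']
      have e : ∀ i ∈ Finset.range k, P (k + 1) / (P (i + 1) * P (k + 1 - (i + 1))) *
          (if i + 1 = 0 then P (k + 1 - (i + 1)) * h (k + 1 - (i + 1))
            else if k + 1 - (i + 1) = 0 then t * (P (i + 1) * h (i + 1))
            else t * r ^ (i + 1) *
              (P (i + 1) * h (i + 1) * (P (k + 1 - (i + 1)) * h (k + 1 - (i + 1))))) =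
          P (k + 1) * (t * (if k + 1 - (i + 1) = 0 then 0
            else r ^ (i + 1) * h (i + 1) * h (k + 1 - (i + 1)))) := by
        intro i hi
        have hi' : k + 1 - (i + 1) ≠ 0 := by rw [Finset.mem_range] at hi; omega
        have h1 := hP (i + 1)
        have h2 := hP (k + 1 - (i + 1))
        rw [if_neg i.succ_ne_zero, if_neg hi', if_neg hi']
        field_simp
      rw [Finset.sum_congr rfl e, ← Finset.mul_sum, ← Finset.mul_sum]
      have h1 : P 0 = 1 := by simp [P, powSubOneProd]
      have h2 := hP (k + 1)
      simp [h0, h1]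
      field_simp
      ring

lemma map_range_succ_eq_cons (f : ℕ → ℕ) (n : ℕ) :
    (List.range (n + 1)).map f = f 0 :: (List.range n).map fun i => f (i + 1) := by
  rw [List.range_succ_eq_map, List.map_cons, List.map_map]
  rfl

lemma headD_map_range (f : ℕ → ℕ) (n d : ℕ) :
    ((List.range n).map f).headD d = if 0 < n then f 0 else d := by
  cases n with
  | zero => rfl
  | succ n => simp [map_range_succ_eq_cons]

lemma admCount_map_range (x k : ℕ) (f : ℕ → ℕ) (n : ℕ) :
    admCount x k ((List.range n).map f) =
      ∑ j ∈ Finset.range n,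
        if f j < x ∧ ((j + 1 < n ∧ f j < f (j + 1)) ∨ k < f j ∨ ∃ i < j, f i < f j)
          then 1 else 0 := by
  induction n generalizing f k with
  | zero => rfl
  | succ n ih =>
    rw [map_range_succ_eq_cons, admCount, ih, Finset.sum_range_succ', add_comm]
    congr 1
    · refine Finset.sum_congr rfl fun j _ => if_congr ?_ rfl rfl
      rw [Nat.exists_lt_succ_left, min_lt_iff]
      simp only [add_lt_add_iff_right]
      tauto
    · refine if_congr ?_ rfl rfl
      rw [headD_map_range]
      split_ifs with h <;> simp [h]

lemma listAi_map_range (f : ℕ → ℕ) (n : ℕ) :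
    listAi ((List.range n).map f) =
      ∑ i ∈ Finset.range n, ∑ j ∈ Finset.range n,
        if i < j ∧ f j < f i ∧ ((j + 1 < n ∧ f j < f (j + 1)) ∨ ∃ k ∈ Finset.Ioo i j, f k < f j)
          then 1 else 0 := by
  induction n generalizing f with
  | zero => rfl
  | succ n ih =>
    rw [map_range_succ_eq_cons, listAi, ih, admCount_map_range, Finset.sum_range_succ', add_comm]
    congr 1
    · refine Finset.sum_congr rfl fun i _ => ?_
      rw [Finset.sum_range_succ']
      simp only [Nat.not_lt_zero, false_and, if_false, add_zero]
      refine Finset.sum_congr rfl fun j _ => if_congr ?_ rfl rfl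
      have : (∃ k ∈ Finset.Ioo (i + 1) (j + 1), f k < f (j + 1)) ↔
          ∃ k ∈ Finset.Ioo i j, f (k + 1) < f (j + 1) := by
        constructor
        · rintro ⟨k, hk, h⟩
          rw [Finset.mem_Ioo] at hk
          obtain ⟨k, rfl⟩ : ∃ k', k = k' + 1 := ⟨k - 1, by omega⟩
          exact ⟨k, Finset.mem_Ioo.2 ⟨by omega, by omega⟩, h⟩
        · rintro ⟨k, hk, h⟩
          rw [Finset.mem_Ioo] at hk
          exact ⟨k + 1, Finset.mem_Ioo.2 ⟨by omega, by omega⟩, h⟩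
      rw [this]
      simp only [add_lt_add_iff_right]
    · rw [Finset.sum_range_succ']
      simp only [lt_self_iff_false, false_and, if_false, add_zero]
      refine Finset.sum_congr rfl fun j _ => if_congr ?_ rfl rfl
      have : (∃ k ∈ Finset.Ioo 0 (j + 1), f k < f (j + 1)) ↔
          ∃ k < j, f (k + 1) < f (j + 1) := by
        constructor
        · rintro ⟨k, hk, h⟩
          rw [Finset.mem_Ioo] at hk
          obtain ⟨k, rfl⟩ : ∃ k', k = k' + 1 := ⟨k - 1, by omega⟩
          exact ⟨k, by omega, h⟩
        · rintro ⟨k, hk, h⟩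
          exact ⟨k + 1, Finset.mem_Ioo.2 ⟨by omega, by omega⟩, h⟩
      rw [this]
      simp only [add_lt_add_iff_right, Nat.succ_pos, true_and]
      have h0 : f (j + 1) < f 0 → ¬ f 0 < f (j + 1) := fun h => h.not_gt
      tauto

lemma listDes_map_range (f : ℕ → ℕ) (n : ℕ) :
    listDes ((List.range n).map f) =
      ∑ i ∈ Finset.range (n - 1), if f (i + 1) < f i then 1 else 0 := by
  induction n generalizing f with
  | zero => rfl
  | succ n ih =>
    rw [map_range_succ_eq_cons, listDes, ih, headD_map_range]
    cases n with
    | zero => simp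
    | succ n => simp [Finset.sum_range_succ' _ n, add_comm]

lemma sum_Icc_one_eq_sum_range {R : Type*} [AddCommMonoid R] (F : ℕ → R) (n : ℕ) :
    ∑ i ∈ Finset.Icc 1 n, F i = ∑ i ∈ Finset.range n, F (i + 1) := by
  rw [Finset.range_eq_Ico, Finset.sum_Ico_add' F 0 n 1]
  rfl

section

variable {n : ℕ}

lemma pv_succ (σ : Equiv.Perm (Fin n)) (i : Fin n) : pv σ (i + 1) = σ i + 1 := by
  have : 1 ≤ (i : ℕ) + 1 ∧ (i : ℕ) + 1 ≤ n := ⟨by omega, by omega⟩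
  rw [pv, dif_pos this]
  simp

lemma aiStat_eq_listAi (σ : Equiv.Perm (Fin n)) :
    aiStat σ = listAi ((List.range n).map fun i => pv σ (i + 1)) := by
  rw [aiStat, Finset.card_filter, Finset.sum_product, sum_Icc_one_eq_sum_range, listAi_map_range]
  refine Finset.sum_congr rfl fun i _ => ?_
  rw [sum_Icc_one_eq_sum_range]
  refine Finset.sum_congr rfl fun j _ => if_congr ?_ rfl rfl
  have : (∃ k ∈ Finset.Ioo (i + 1) (j + 1), pv σ k < pv σ (j + 1)) ↔
      ∃ k ∈ Finset.Ioo i j, pv σ (k + 1) < pv σ (j + 1) := by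
    constructor
    · rintro ⟨k, hk, h⟩
      rw [Finset.mem_Ioo] at hk
      obtain ⟨k, rfl⟩ : ∃ k', k = k' + 1 := ⟨k - 1, by omega⟩
      exact ⟨k, Finset.mem_Ioo.2 ⟨by omega, by omega⟩, h⟩
    · rintro ⟨k, hk, h⟩
      rw [Finset.mem_Ioo] at hk
      exact ⟨k + 1, Finset.mem_Ioo.2 ⟨by omega, by omega⟩, h⟩
  rw [this]
  simp only [add_lt_add_iff_right]

lemma desStat_eq_listDes (σ : Equiv.Perm (Fin n)) :
    desStat σ = listDes ((List.range n).map fun i => pv σ (i + 1)) := by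
  rw [desStat, DesSet, Finset.card_filter, sum_Icc_one_eq_sum_range, listDes_map_range]

lemma card_orderings (V : Finset ℕ) : (orderings V).card = V.card.factorial := by
  rw [orderings, List.toFinset_card_of_nodup (List.nodup_permutations _ V.nodup_toList),
    List.length_permutations, Finset.length_toList]

lemma sum_perm_eq_sum_orderings {R : Type*} [AddCommMonoid R] (F : List ℕ → R) :
    ∑ σ : Equiv.Perm (Fin n), F ((List.range n).map fun i => pv σ (i + 1)) =
      ∑ l ∈ orderings (Finset.Icc 1 n), F l := by
  have hmem : ∀ σ : Equiv.Perm (Fin n),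
      ((List.range n).map fun i => pv σ (i + 1)) ∈ orderings (Finset.Icc 1 n) := by
    intro σ
    have hinj : Set.InjOn (fun i => pv σ (i + 1)) (Finset.range n) := by
      intro i hi j hj h
      simp only [Finset.coe_range, Set.mem_Iio] at hi hj
      have h' : pv σ ((⟨i, hi⟩ : Fin n) + 1) = pv σ ((⟨j, hj⟩ : Fin n) + 1) := h
      rw [pv_succ, pv_succ] at h'
      simpa using σ.injective (Fin.ext (Nat.succ_injective h'))
    have hnd : ((List.range n).map fun i => pv σ (i + 1)).Nodup :=
      List.Nodup.map_on (fun x hx y hy h => hinj (by simpa using hx) (by simpa using hy) h)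
        List.nodup_range
    refine mem_orderings.2 ⟨hnd, Finset.eq_of_subset_of_card_le ?_ ?_⟩
    · intro x hx
      simp only [List.mem_toFinset, List.mem_map, List.mem_range] at hx
      obtain ⟨i, hi, rfl⟩ := hx
      have := pv_succ σ ⟨i, hi⟩
      simp only at this
      rw [this, Finset.mem_Icc]
      omega
    · rw [List.toFinset_card_of_nodup hnd]
      simp
  have hinj : Function.Injective
      fun σ : Equiv.Perm (Fin n) => (List.range n).map fun i => pv σ (i + 1) := by
    intro σ τ h
    ext i
    have h := (List.map_inj_left.1 h) i (by simp)
    rw [pv_succ, pv_succ] at h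
    omega
  refine Finset.sum_nbij _ (fun σ _ => hmem σ) hinj.injOn ?_ fun _ _ => rfl
  intro l hl
  obtain ⟨σ, hσ, h⟩ := Finset.surj_on_of_inj_on_of_card_le (s := Finset.univ)
    (fun (σ : Equiv.Perm (Fin n)) _ => (List.range n).map fun i => pv σ (i + 1))
    (fun σ _ => hmem σ) (fun σ τ _ _ h => hinj h)
    (by simp [card_orderings, Fintype.card_perm]) l hl
  exact ⟨σ, hσ, h.symm⟩

end

/-- The weight of an arc from block `b` to block `c`. -/
def arcWeight (t : ℝ) (b c : ℕ) : ℝ := if c < b then t else if b < c then 1 else 0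

/-- The generating polynomial of the arcs from block `b` to other blocks. -/
noncomputable def arcPoly (t : ℝ) (B b : ℕ) : MvPolynomial ℕ ℝ :=
  ∑ c ∈ Finset.range B, MvPolynomial.C (arcWeight t b c) * MvPolynomial.X c

/-- The generating polynomial of the families of `k` arcs leaving block `b`, of which only the first
may be a loop. -/
noncomputable def blockPoly (t : ℝ) (B b k : ℕ) : MvPolynomial ℕ ℝ :=
  if k = 0 then 1 else arcPoly t B b ^ (k - 1) * (arcPoly t B b + MvPolynomial.X b)

/-- The generating polynomial of the families of arcs with out-degrees `d`. -/
noncomputable def arrayPoly (t : ℝ) (B : ℕ) (d : ℕ →₀ ℕ) : MvPolynomial ℕ ℝ :=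
  ∏ b ∈ Finset.range B, blockPoly t B b (d b)

/-- The monomial `∏ x b ^ d b`. -/
def monomialWeight (x : ℕ → ℝ) (d : ℕ →₀ ℕ) : ℝ := d.prod fun b k => x b ^ k

/-- The generating function of balanced families of `n` arcs on the blocks below `M`. -/
noncomputable def balancedSum (t : ℝ) (B : ℕ) (x : ℕ → ℝ) (M n : ℕ) : ℝ :=
  ∑ d ∈ (Finset.range M).finsuppAntidiag n, monomialWeight x d * (arrayPoly t B d).coeff d

/-- The generating function of families of `n` arcs on the blocks up to `M` whose in-degrees and
out-degrees differ by a path from `p` to `M`. -/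
noncomputable def pathSum (t : ℝ) (B : ℕ) (x : ℕ → ℝ) (M p n : ℕ) : ℝ :=
  ∑ d ∈ (Finset.range (M + 1)).finsuppAntidiag n,
    monomialWeight x d * (MvPolynomial.X p * arrayPoly t B d).coeff (d + Finsupp.single M 1)

lemma monomialWeight_add_single (x : ℕ → ℝ) (d : ℕ →₀ ℕ) (p : ℕ) :
    monomialWeight x (d + Finsupp.single p 1) = x p * monomialWeight x d := by
  rw [monomialWeight, Finsupp.prod_add_index' (by simp) (by intros; rw [pow_add]),
    Finsupp.prod_single_index (by simp), pow_one, mul_comm]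
  rfl

lemma arrayPoly_add_single {t : ℝ} {B p : ℕ} (hp : p < B) (d : ℕ →₀ ℕ) :
    arrayPoly t B (d + Finsupp.single p 1) =
      (if d p = 0 then arcPoly t B p + MvPolynomial.X p else arcPoly t B p) * arrayPoly t B d := by
  have hp' := Finset.mem_range.2 hp
  rw [arrayPoly, arrayPoly, ← Finset.mul_prod_erase _ _ hp', ← Finset.mul_prod_erase _ _ hp',
    ← mul_assoc]
  congr 1
  · rw [Finsupp.add_apply, Finsupp.single_eq_same, blockPoly, if_neg (Nat.succ_ne_zero _), blockPoly]
    split_ifs with h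
    · simp [h]
    · obtain ⟨k, hk⟩ := Nat.exists_eq_succ_of_ne_zero h
      rw [hk]
      simp only [Nat.succ_eq_add_one, Nat.add_sub_cancel, pow_succ]
      ring
  · refine Finset.prod_congr rfl fun b hb => ?_
    rw [Finsupp.add_apply, Finsupp.single_eq_of_ne (Finset.ne_of_mem_erase hb), add_zero]

lemma coeff_X_mul_eq_zero {m : ℕ →₀ ℕ} {p : ℕ} (h : m p = 0) (Q : MvPolynomial ℕ ℝ) :
    (MvPolynomial.X p * Q).coeff m = 0 := by
  classical
  rw [MvPolynomial.coeff_X_mul', if_neg (by simpa using h)]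

lemma coeff_arcPoly_mul (t : ℝ) (B b : ℕ) (m : ℕ →₀ ℕ) (Q : MvPolynomial ℕ ℝ) :
    (arcPoly t B b * Q).coeff m =
      ∑ c ∈ Finset.range B, arcWeight t b c * (MvPolynomial.X c * Q).coeff m := by
  rw [arcPoly, Finset.sum_mul, MvPolynomial.coeff_sum]
  refine Finset.sum_congr rfl fun c _ => ?_
  rw [mul_assoc, MvPolynomial.coeff_C_mul]

lemma sum_finsuppAntidiag_succ {S : Finset ℕ} {p : ℕ} (hp : p ∈ S) (n : ℕ) (F : (ℕ →₀ ℕ) → ℝ) :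
    ∑ d ∈ S.finsuppAntidiag (n + 1), F d =
      ∑ d ∈ (S.finsuppAntidiag (n + 1)).filter (fun d => d p = 0), F d +
        ∑ d ∈ S.finsuppAntidiag n, F (d + Finsupp.single p 1) := by
  rw [← Finset.sum_filter_add_sum_filter_not _ fun d : ℕ →₀ ℕ => d p = 0]
  congr 1
  symm
  refine Finset.sum_nbij (· + Finsupp.single p 1) ?_ (add_left_injective _).injOn ?_ fun _ _ => rfl
  · intro d hd
    rw [Finset.mem_finsuppAntidiag] at hd
    rw [Finset.mem_filter, Finset.mem_finsuppAntidiag]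
    refine ⟨⟨?_, ?_⟩, by simp⟩
    · simp [Finset.sum_add_distrib, hd.1, Finsupp.single_apply, hp]
    · refine Finsupp.support_add.trans (Finset.union_subset hd.2 ?_)
      exact Finsupp.support_single_subset.trans (Finset.singleton_subset_iff.2 hp)
  · intro d hd
    rw [Finset.mem_coe, Finset.mem_filter, Finset.mem_finsuppAntidiag] at hd
    obtain ⟨⟨hd1, hd2⟩, hd3⟩ := hd
    have hle : Finsupp.single p 1 ≤ d := by
      rw [Finsupp.single_le_iff]
      omega
    refine ⟨d - Finsupp.single p 1, ?_, tsub_add_cancel_of_le hle⟩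
    rw [Finset.mem_coe, Finset.mem_finsuppAntidiag]
    refine ⟨?_, Finsupp.support_tsub.trans hd2⟩
    have h : ∑ b ∈ S, (d - Finsupp.single p 1 + Finsupp.single p 1 : ℕ →₀ ℕ) b = n + 1 := by
      rw [tsub_add_cancel_of_le hle]; exact hd1
    simp only [Finsupp.add_apply, Finset.sum_add_distrib] at h
    simpa [Finsupp.single_apply, hp] using h

lemma filter_finsuppAntidiag_range_succ (M n : ℕ) :
    ((Finset.range (M + 1)).finsuppAntidiag n).filter (fun d => d M = 0) =
      (Finset.range M).finsuppAntidiag n := by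
  ext d
  rw [Finset.mem_filter, Finset.mem_finsuppAntidiag, Finset.mem_finsuppAntidiag,
    Finset.sum_range_succ]
  constructor
  · rintro ⟨⟨h1, h2⟩, h3⟩
    refine ⟨by simpa [h3] using h1, fun b hb => ?_⟩
    have := Finset.mem_range.1 (h2 hb)
    have hne : b ≠ M := by rintro rfl; exact (Finsupp.mem_support_iff.1 hb) h3
    rw [Finset.mem_range]
    omega
  · rintro ⟨h1, h2⟩
    have h3 : d M = 0 := by
      by_contra h
      simpa using h2 (Finsupp.mem_support_iff.2 h)
    exact ⟨⟨by simpa [h3] using h1, h2.trans (Finset.range_mono M.le_succ)⟩, h3⟩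

lemma pathSum_self (t : ℝ) (B : ℕ) (x : ℕ → ℝ) (M n : ℕ) :
    pathSum t B x M M n = balancedSum t B x (M + 1) n := by
  refine Finset.sum_congr rfl fun d _ => ?_
  rw [add_comm d, MvPolynomial.coeff_X_mul]

section

variable {t : ℝ} {B M : ℕ} (x : ℕ → ℝ)

lemma sum_arcWeight_mul_coeff (hM : M < B) (p n : ℕ) :
    ∑ d ∈ (Finset.range (M + 1)).finsuppAntidiag n, x p * monomialWeight x d *
        (arcPoly t B p * arrayPoly t B d).coeff (d + Finsupp.single M 1) =
      x p * ∑ c ∈ Finset.range (M + 1), arcWeight t p c * pathSum t B x M c n := by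
  simp only [pathSum, Finset.mul_sum]
  rw [Finset.sum_comm]
  refine Finset.sum_congr rfl fun d hd => ?_
  rw [Finset.mem_finsuppAntidiag] at hd
  rw [coeff_arcPoly_mul, Finset.mul_sum]
  rw [← Finset.sum_subset (Finset.range_mono (Nat.succ_le_of_lt hM))]
  · refine Finset.sum_congr rfl fun c _ => ?_
    ring
  · intro c _ hc
    rw [Finset.mem_range] at hc
    have h1 : d c = 0 := by
      by_contra h
      exact hc (by simpa using hd.2 (Finsupp.mem_support_iff.2 h))
    rw [coeff_X_mul_eq_zero, mul_zero, mul_zero]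
    rw [Finsupp.add_apply, h1, Finsupp.single_eq_of_ne (by omega), add_zero]

lemma pathSum_succ (hM : M < B) {p : ℕ} (hp : p < M) (n : ℕ) :
    pathSum t B x M p (n + 1) =
      x p * ∑ c ∈ Finset.range (M + 1), arcWeight t p c * pathSum t B x M c n := by
  rw [← sum_arcWeight_mul_coeff x hM, pathSum,
    sum_finsuppAntidiag_succ (Finset.mem_range.2 (hp.trans M.lt_succ_self)), Finset.sum_eq_zero,
    zero_add]
  · refine Finset.sum_congr rfl fun d _ => ?_
    rw [monomialWeight_add_single, add_right_comm, add_comm _ (Finsupp.single p 1),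
      MvPolynomial.coeff_X_mul,
      arrayPoly_add_single (hp.trans hM)]
    split_ifs with h
    · rw [add_mul, MvPolynomial.coeff_add, coeff_X_mul_eq_zero (p := p), add_zero]
      rw [Finsupp.add_apply, h, Finsupp.single_eq_of_ne (by omega), add_zero]
    · rfl
  · intro d hd
    rw [coeff_X_mul_eq_zero, mul_zero]
    rw [Finsupp.add_apply, (Finset.mem_filter.1 hd).2, Finsupp.single_eq_of_ne (by omega), add_zero]

lemma balancedSum_succ_succ (hM : M < B) (n : ℕ) :
    balancedSum t B x (M + 1) (n + 1) = balancedSum t B x M (n + 1) +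
      x M * (∑ c ∈ Finset.range (M + 1), arcWeight t M c * pathSum t B x M c n +
        balancedSum t B x M n) := by
  rw [mul_add, ← sum_arcWeight_mul_coeff x hM, balancedSum,
    sum_finsuppAntidiag_succ (Finset.self_mem_range_succ M), filter_finsuppAntidiag_range_succ,
    balancedSum, balancedSum, ← filter_finsuppAntidiag_range_succ M n, Finset.sum_filter,
    Finset.mul_sum, ← Finset.sum_add_distrib]
  congr 1
  refine Finset.sum_congr rfl fun d _ => ?_
  rw [monomialWeight_add_single, arrayPoly_add_single hM]
  split_ifs with h
  · rw [add_mul, MvPolynomial.coeff_add, add_comm d, MvPolynomial.coeff_X_mul]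
    ring
  · ring

end

section

variable (t : ℝ) (B : ℕ) (x : ℕ → ℝ)

lemma balancedSum_zero_right (M : ℕ) : balancedSum t B x M 0 = 1 := by
  rw [balancedSum, Finset.finsuppAntidiag_zero, Finset.sum_singleton]
  simp [monomialWeight, arrayPoly, blockPoly]

lemma balancedSum_zero_left (n : ℕ) : balancedSum t B x 0 n = if n = 0 then 1 else 0 := by
  split_ifs with h
  · rw [h, balancedSum_zero_right]
  · rw [balancedSum, Finset.range_zero, Finset.finsuppAntidiag_empty_of_ne_zero h, Finset.sum_empty]

lemma pathSum_zero {M p : ℕ} (hp : p < M) : pathSum t B x M p 0 = 0 := by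
  rw [pathSum, Finset.finsuppAntidiag_zero, Finset.sum_singleton, coeff_X_mul_eq_zero, mul_zero]
  rw [Finsupp.add_apply, Finsupp.single_eq_of_ne (by omega)]
  rfl

/-- The generating series of balanced families of arcs on the blocks below `M`. -/
noncomputable def balancedSeries (M : ℕ) : PowerSeries ℝ := PowerSeries.mk (balancedSum t B x M)

lemma balancedSeries_zero : balancedSeries t B x 0 = 1 := by
  ext n
  rw [balancedSeries, PowerSeries.coeff_mk, balancedSum_zero_left, PowerSeries.coeff_one]

variable {t B}

lemma pathSeries_eq {M p : ℕ} (hM : M < B) (hp : p < M) :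
    PowerSeries.mk (pathSum t B x M p) = PowerSeries.X * PowerSeries.C (x p) *
      (∑ c ∈ Finset.range M, PowerSeries.C (arcWeight t p c) * PowerSeries.mk (pathSum t B x M c) +
        balancedSeries t B x (M + 1)) := by
  ext n
  rw [mul_assoc]
  cases n with
  | zero => simp [pathSum_zero t B x hp]
  | succ n =>
    rw [PowerSeries.coeff_succ_X_mul, PowerSeries.coeff_mk, pathSum_succ x hM hp,
      PowerSeries.coeff_C_mul, Finset.sum_range_succ, pathSum_self, map_add, map_sum]
    simp [balancedSeries, arcWeight, hp, hp.not_gt]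

lemma balancedSeries_succ_eq {M : ℕ} (hM : M < B) :
    balancedSeries t B x (M + 1) = balancedSeries t B x M + PowerSeries.X * PowerSeries.C (x M) *
      (PowerSeries.C t * ∑ c ∈ Finset.range M, PowerSeries.mk (pathSum t B x M c) +
        balancedSeries t B x M) := by
  ext n
  rw [mul_assoc]
  cases n with
  | zero => simp [balancedSeries, balancedSum_zero_right]
  | succ n =>
    rw [map_add, PowerSeries.coeff_succ_X_mul, balancedSeries, PowerSeries.coeff_mk,
      balancedSum_succ_succ x hM, PowerSeries.coeff_C_mul, Finset.sum_range_succ, map_add,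
      PowerSeries.coeff_C_mul, map_sum, Finset.mul_sum]
    have : ∀ c ∈ Finset.range M, arcWeight t M c * pathSum t B x M c n =
        t * PowerSeries.coeff n (PowerSeries.mk (pathSum t B x M c)) := by
      intro c hc
      rw [arcWeight, if_pos (Finset.mem_range.1 hc), PowerSeries.coeff_mk]
    rw [Finset.sum_congr rfl this]
    simp [balancedSeries, arcWeight]

lemma sum_eq_of_arc_system {M : ℕ} (hM : M ≤ B) (Z : ℕ → PowerSeries ℝ) (c : PowerSeries ℝ)
    (hZ : ∀ p < M, Z p = PowerSeries.X * PowerSeries.C (x p) *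
      (∑ b ∈ Finset.range M, PowerSeries.C (arcWeight t p b) * Z b + c)) :
    ∑ p ∈ Finset.range M, Z p = c * (balancedSeries t B x M - 1) := by
  induction M generalizing Z c with
  | zero => simp [balancedSeries_zero]
  | succ M ih =>
    set y := PowerSeries.X * PowerSeries.C (x M) with hy
    set a := balancedSeries t B x M with ha
    set b := balancedSeries t B x (M + 1) with hb
    set T := PowerSeries.C (R := ℝ) t
    have h1 := ih (by omega) Z (c + Z M) fun p hp => by
      rw [hZ p (by omega), Finset.sum_range_succ, arcWeight, if_neg (by omega), if_pos hp, map_one]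
      ring
    have h2 : Z M = y * (T * ∑ p ∈ Finset.range M, Z p + c) := by
      rw [hZ M (by omega), Finset.sum_range_succ, arcWeight, if_neg (by omega), if_neg (by omega),
        map_zero, zero_mul, add_zero, Finset.mul_sum]
      congr 2
      refine Finset.sum_congr rfl fun p (hp : p ∈ Finset.range M) => ?_
      rw [arcWeight, if_pos (Finset.mem_range.1 hp)]
    have h3 := balancedSeries_succ_eq (t := t) x (Nat.lt_of_succ_le hM)
    have h4 := ih (by omega) (fun p => PowerSeries.mk (pathSum t B x M p)) b
      fun p hp => pathSeries_eq x (Nat.lt_of_succ_le hM) hp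
    have hu : (1 - T * y * (a - 1)) ≠ 0 := by
      intro h
      have := congrArg PowerSeries.constantCoeff h
      simp [hy] at this
    rw [h4] at h3
    rw [Finset.sum_range_succ]
    apply mul_left_cancel₀ hu
    rw [h1] at h2 ⊢
    linear_combination (a) * h2 - c * h3

/-- The Riccati recursion for balanced families of arcs. -/
lemma balancedSeries_succ {M : ℕ} (hM : M < B) :
    balancedSeries t B x (M + 1) = balancedSeries t B x M + PowerSeries.X * PowerSeries.C (x M) *
      (PowerSeries.C t * (balancedSeries t B x (M + 1) * (balancedSeries t B x M - 1)) +
        balancedSeries t B x M) := by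
  conv_lhs => rw [balancedSeries_succ_eq x hM]
  rw [sum_eq_of_arc_system x hM.le _ _ fun p hp => pathSeries_eq x hM hp]

end

/-- The multiset of values of `s`, as a finitely supported function. -/
noncomputable def content {n : ℕ} (s : Fin n → ℕ) : ℕ →₀ ℕ := ∑ i, Finsupp.single (s i) 1

lemma content_succ {n : ℕ} (s : Fin (n + 1) → ℕ) :
    content s = content (fun i => s i.castSucc) + Finsupp.single (s (Fin.last n)) 1 := by
  rw [content, Fin.sum_univ_castSucc, content]

lemma content_apply_eq_zero {n : ℕ} {s : Fin n → ℕ} {b : ℕ} :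
    content s b = 0 ↔ ∀ i, s i ≠ b := by
  rw [content, Finsupp.finsetSum_apply, Finset.sum_eq_zero_iff]
  simp [Finsupp.single_apply]

lemma toMultiset_content {n : ℕ} (s : Fin n → ℕ) :
    Finsupp.toMultiset (content s) = (Finset.univ : Finset (Fin n)).val.map s := by
  rw [content, map_sum]
  simp only [Finsupp.toMultiset_single, one_smul]
  change (Finset.univ.val.map fun i => ({s i} : Multiset ℕ)).sum = _
  conv_rhs => rw [← Multiset.sum_map_singleton (Finset.univ.val.map s), Multiset.map_map]
  rfl

lemma content_comp_perm {n : ℕ} (s : Fin n → ℕ) (σ : Equiv.Perm (Fin n)) :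
    content (fun i => s (σ i)) = content s :=
  Equiv.sum_comp σ fun i => Finsupp.single (s i) 1

lemma eq_of_monotone_of_content_eq {n : ℕ} {s w : Fin n → ℕ} (hs : Monotone s) (hw : Monotone w)
    (h : content s = content w) : s = w := by
  have h' := congrArg Finsupp.toMultiset h
  rw [toMultiset_content, toMultiset_content, Fin.univ_val_map, Fin.univ_val_map] at h'
  exact List.ofFn_injective <| (Multiset.coe_eq_coe.1 h').eq_of_pairwise' hs.sortedLE_ofFn.pairwise
    hw.sortedLE_ofFn.pairwise

lemma exists_monotone_content_eq {M n : ℕ} {d : ℕ →₀ ℕ}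
    (hd : d ∈ (Finset.range M).finsuppAntidiag n) :
    ∃ s : Fin n → ℕ, Monotone s ∧ (∀ i, s i < M) ∧ content s = d := by
  rw [Finset.mem_finsuppAntidiag] at hd
  have hcard : (Finsupp.toMultiset d).card = n := by
    rw [Finsupp.card_toMultiset, Finsupp.sum, ← hd.1]
    exact Finset.sum_subset hd.2 fun b _ hb => by simpa using hb
  have hlen : ((Finsupp.toMultiset d).sort (· ≤ ·)).length = n := by
    rw [Multiset.length_sort, hcard]
  subst hlen
  refine ⟨((Finsupp.toMultiset d).sort (· ≤ ·)).get, ?_, fun i => ?_, ?_⟩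
  · exact (Multiset.pairwise_sort _ _).sortedLE.monotone_get
  · have := List.get_mem _ i
    rw [Multiset.mem_sort, Finsupp.mem_toMultiset] at this
    exact Finset.mem_range.1 (hd.2 this)
  · rw [← Finsupp.toMultiset_toFinsupp (content _), toMultiset_content, Fin.univ_val_map,
      List.ofFn_get, Multiset.sort_eq, Finsupp.toMultiset_toFinsupp]

lemma sum_finsuppAntidiag_eq_sum_monotone (M n : ℕ) (F : (ℕ →₀ ℕ) → ℝ) :
    ∑ d ∈ (Finset.range M).finsuppAntidiag n, F d =
      ∑ s ∈ (Fintype.piFinset fun _ : Fin n => Finset.range M).filter Monotone,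
        F (content s) := by
  symm
  refine Finset.sum_nbij content ?_ ?_ ?_ fun _ _ => rfl
  · intro s hs
    rw [Finset.mem_filter, Fintype.mem_piFinset] at hs
    rw [Finset.mem_finsuppAntidiag]
    have hsub : (content s).support ⊆ Finset.range M := by
      intro b hb
      rw [Finsupp.mem_support_iff, Ne, content_apply_eq_zero] at hb
      push Not at hb
      obtain ⟨i, rfl⟩ := hb
      exact hs.1 i
    refine ⟨?_, hsub⟩
    have := Finsupp.card_toMultiset (content s)
    rw [toMultiset_content, Multiset.card_map] at this
    simp only [Finset.card_val, Finset.card_univ, Fintype.card_fin] at this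
    refine Eq.trans ?_ this.symm
    exact (Finset.sum_subset hsub fun b _ hb => by simpa using hb).symm
  · intro s hs w hw h
    rw [Finset.mem_coe, Finset.mem_filter] at hs hw
    exact eq_of_monotone_of_content_eq hs.2 hw.2 h
  · intro d hd
    obtain ⟨s, h1, h2, h3⟩ := exists_monotone_content_eq hd
    exact ⟨s, by simp [h1, h2], h3⟩

lemma monomialWeight_content {n : ℕ} (x : ℕ → ℝ) (s : Fin n → ℕ) :
    monomialWeight x (content s) = ∏ i, x (s i) := by
  induction n with
  | zero => simp [content, monomialWeight]
  | succ n ih =>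
    rw [content_succ, monomialWeight_add_single, ih, Fin.prod_univ_castSucc, mul_comm]

/-- The weight of an arc to `c` that leaves from `s j`, where loops are only allowed on the first
occurrence of a value. -/
noncomputable def slotWeight (t : ℝ) {n : ℕ} (s : Fin n → ℕ) (j : Fin n) (c : ℕ) : ℝ :=
  open Classical in
  if c < s j then t else if s j < c then 1 else if ∀ i < j, s i ≠ s j then 1 else 0

lemma arrayPoly_content {t : ℝ} {B n : ℕ} (s : Fin n → ℕ) (hs : ∀ i, s i < B) :
    arrayPoly t B (content s) = ∏ j, ∑ c ∈ Finset.range B,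
      MvPolynomial.C (slotWeight t s j c) * MvPolynomial.X c := by
  classical
  induction n with
  | zero => simp [content, arrayPoly, blockPoly]
  | succ n ih =>
    rw [content_succ, arrayPoly_add_single (hs _), ih _ fun i => hs _, Fin.prod_univ_castSucc,
      mul_comm]
    congr 1
    · refine Finset.prod_congr rfl fun j _ => Finset.sum_congr rfl fun c _ => ?_
      have : (∀ i < j, s i.castSucc ≠ s j.castSucc) ↔
          ∀ i < j.castSucc, s i ≠ s j.castSucc := by
        rw [Fin.forall_fin_succ']
        simp [(Fin.le_last _).not_gt]
      simp only [slotWeight, this]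
    · have : (∀ i < Fin.last n, s i ≠ s (Fin.last n)) ↔
          content (fun i : Fin n => s i.castSucc) (s (Fin.last n)) = 0 := by
        rw [content_apply_eq_zero, Fin.forall_fin_succ']
        simp [Fin.castSucc_lt_last]
      have h2 : ∀ c, slotWeight t s (Fin.last n) c = arcWeight t (s (Fin.last n)) c +
          if content (fun i : Fin n => s i.castSucc) (s (Fin.last n)) = 0 then
            (if c = s (Fin.last n) then 1 else 0) else 0 := by
        intro c
        rw [slotWeight, arcWeight]
        simp only [this]
        split_ifs <;> first | omega | simp
      simp only [h2, map_add, add_mul, Finset.sum_add_distrib, arcPoly]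
      split_ifs
      · simp [hs]
      · simp

lemma coeff_arrayPoly_content {t : ℝ} {B n : ℕ} (s : Fin n → ℕ) (hs : ∀ i, s i < B) :
    (arrayPoly t B (content s)).coeff (content s) =
      ∑ w ∈ (Fintype.piFinset fun _ : Fin n => Finset.range B).filter
        (fun w => content w = content s), ∏ j, slotWeight t s j (w j) := by
  classical
  rw [arrayPoly_content s hs, Finset.prod_univ_sum, MvPolynomial.coeff_sum, Finset.sum_filter]
  refine Finset.sum_congr rfl fun w _ => ?_
  have : ∏ j, (MvPolynomial.X (w j) : MvPolynomial ℕ ℝ) = MvPolynomial.monomial (content w) 1 := by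
    rw [content, MvPolynomial.monomial_sum_one]
    rfl
  rw [Finset.prod_mul_distrib, this, ← map_prod, MvPolynomial.coeff_C_mul,
    MvPolynomial.coeff_monomial]
  split_ifs <;> simp

lemma prod_slotWeight {n : ℕ} (t : ℝ) (s w : Fin n → ℕ) :
    open Classical in
    ∏ j, slotWeight t s j (w j) =
      if ∀ j, w j = s j → ∀ i < j, s i ≠ s j then
        t ^ (Finset.univ.filter fun j => w j < s j).card else 0 := by
  classical
  split_ifs with h
  · rw [← Finset.prod_const, Finset.prod_filter]
    refine Finset.prod_congr rfl fun j _ => ?_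
    rw [slotWeight]
    split_ifs with h1 h2 h3
    · rfl
    · rfl
    · rfl
    · exact absurd (h j (by omega)) h3
  · push Not at h
    obtain ⟨j, h1, i, h2⟩ := h
    refine Finset.prod_eq_zero (Finset.mem_univ j) ?_
    rw [slotWeight, if_neg (by omega), if_neg (by omega), if_neg]
    exact fun h => h i h2.1 h2.2

/-- A key whose descents along positions record the descents of `σ` up to excedances. -/
def excKey {n : ℕ} (σ : Equiv.Perm (Fin n)) (i : Fin n) : ℕ :=
  (if i < σ i then n else 0) + (n - 1 - σ i)

/-- The increasing sequences with a strict increase at each descent of `excKey σ`. -/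
def Compat {n : ℕ} (s : Fin n → ℕ) (σ : Equiv.Perm (Fin n)) : Prop :=
  StrictMono fun i => 2 * n * s i + excKey σ i

lemma excKey_lt {n : ℕ} (σ : Equiv.Perm (Fin n)) (i : Fin n) : excKey σ i < 2 * n := by
  rw [excKey]
  split_ifs <;> omega

lemma lt_or_eq_and_lt_of_mul_add_lt {m a b k l : ℕ} (hl : l < m) (h : m * a + k < m * b + l) :
    a < b ∨ a = b ∧ k < l := by
  rcases lt_trichotomy a b with hab | rfl | hab
  · exact Or.inl hab
  · exact Or.inr ⟨rfl, by omega⟩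
  · have : m * (b + 1) ≤ m * a := Nat.mul_le_mul_left m hab
    rw [mul_add] at this
    omega

lemma mul_add_lt_of_lt {m a b k l : ℕ} (hk : k < m) (h : a < b) : m * a + k < m * b + l := by
  have : m * (a + 1) ≤ m * b := Nat.mul_le_mul_left m h
  rw [mul_add] at this
  omega

section

variable {n : ℕ} {s : Fin n → ℕ} {σ : Equiv.Perm (Fin n)}

lemma Compat.monotone (h : Compat s σ) : Monotone s := by
  refine monotone_iff_forall_lt.2 fun i j hij => ?_
  rcases lt_or_eq_and_lt_of_mul_add_lt (excKey_lt σ j) (h hij) with h | h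
  · exact h.le
  · exact h.1.le

lemma Compat.excKey_lt_excKey (h : Compat s σ) {i j : Fin n} (hij : i < j) (hs : s i = s j) :
    excKey σ i < excKey σ j := by
  have := h hij
  simp only [hs] at this
  omega

lemma Compat.lt_apply_iff (h : Compat s σ) (i : Fin n) : i < σ i ↔ s i < s (σ i) := by
  refine ⟨fun hi => (h.monotone hi.le).lt_of_ne fun hs => ?_, fun hs => ?_⟩
  · have := h.excKey_lt_excKey hi hs
    rw [excKey, excKey, if_pos hi] at this
    split_ifs at this with h2 <;> omega
  · by_contra hi
    exact hs.not_ge (h.monotone (not_lt.1 hi))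

lemma Compat.ne_of_lt_apply (h : Compat s σ) {i j : Fin n} (hs : s i = s (σ i)) (hj : j < σ i) :
    s j ≠ s (σ i) := by
  intro hsj
  have hi : ¬ i < σ i := by rw [h.lt_apply_iff, hs]; exact lt_irrefl _
  have := h.excKey_lt_excKey (hj.trans_le (not_lt.1 hi)) (hsj.trans hs.symm)
  rw [excKey, excKey, if_neg hi] at this
  split_ifs at this with h2 <;> omega

/-- The key used for sorting a sequence `w` into the increasing sequence `s`. -/
def sortKey (s w : Fin n → ℕ) (j : Fin n) : ℕ :=
  2 * n * w j + ((if w j < s j then n else 0) + (n - 1 - j))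

lemma sortKey_injective (s w : Fin n → ℕ) : Function.Injective (sortKey s w) := by
  have key : ∀ i j, sortKey s w i = sortKey s w j → ¬ i < j := by
    intro i j h hij
    rw [sortKey, sortKey] at h
    rcases lt_trichotomy (w i) (w j) with h1 | h1 | h1
    · have := mul_add_lt_of_lt (m := 2 * n) (k := (if w i < s i then n else 0) + (n - 1 - i))
        (l := (if w j < s j then n else 0) + (n - 1 - j)) (by split_ifs <;> omega) h1
      omega
    · rw [h1] at h
      split_ifs at h <;> omega
    · have := mul_add_lt_of_lt (m := 2 * n) (k := (if w j < s j then n else 0) + (n - 1 - j))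
        (l := (if w i < s i then n else 0) + (n - 1 - i)) (by split_ifs <;> omega) h1
      omega
  intro i j h
  exact le_antisymm (not_lt.1 (key j i h.symm)) (not_lt.1 (key i j h))

lemma sortKey_apply {w : Fin n → ℕ} (hw : ∀ i, w (σ i) = s i)
    (h : ∀ i, i < σ i ↔ s i < s (σ i)) (i : Fin n) :
    sortKey s w (σ i) = 2 * n * s i + excKey σ i := by
  rw [sortKey, excKey, hw]
  simp only [h]

lemma sum_compat_eq_sum_words (t : ℝ) {B : ℕ} (hs : Monotone s) (hB : ∀ i, s i < B) :
    open Classical in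
    ∑ σ : Equiv.Perm (Fin n), (if Compat s σ then t ^ (Finset.univ.filter fun i => i < σ i).card
        else 0) =
      ∑ w ∈ (Fintype.piFinset fun _ : Fin n => Finset.range B).filter
        (fun w => content w = content s), ∏ j, slotWeight t s j (w j) := by
  classical
  simp only [prod_slotWeight]
  rw [← Finset.sum_filter, ← Finset.sum_filter]
  refine Finset.sum_nbij (fun σ j => s (σ.symm j)) ?_ ?_ ?_ ?_
  · intro σ hσ
    have hc : Compat s σ := (Finset.mem_filter.1 hσ).2
    simp only [Finset.mem_filter, Fintype.mem_piFinset, Finset.mem_range]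
    refine ⟨⟨fun _ => hB _, content_comp_perm s σ.symm⟩, fun j hj i hi => ?_⟩
    obtain ⟨k, rfl⟩ := σ.surjective j
    rw [Equiv.symm_apply_apply] at hj
    exact hc.ne_of_lt_apply hj hi
  · intro σ hσ τ hτ h
    have hσ : Compat s σ := (Finset.mem_filter.1 hσ).2
    have hτ : Compat s τ := (Finset.mem_filter.1 hτ).2
    have h1 : ∀ i, sortKey s (fun j => s (σ.symm j)) (σ i) = 2 * n * s i + excKey σ i :=
      sortKey_apply (by simp) hσ.lt_apply_iff
    have h2 : ∀ i, sortKey s (fun j => s (τ.symm j)) (τ i) = 2 * n * s i + excKey τ i :=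
      sortKey_apply (by simp) hτ.lt_apply_iff
    have h3 : (fun j => s (σ.symm j)) = fun j => s (τ.symm j) := h
    rw [← h3] at h2
    have m1 : Monotone (sortKey s (fun j => s (σ.symm j)) ∘ σ) := by
      have : sortKey s (fun j => s (σ.symm j)) ∘ σ = _ := funext h1
      rw [this]
      exact StrictMono.monotone hσ
    have m2 : Monotone (sortKey s (fun j => s (σ.symm j)) ∘ τ) := by
      have : sortKey s (fun j => s (σ.symm j)) ∘ τ = _ := funext h2
      rw [this]
      exact StrictMono.monotone hτ
    ext i
    rw [sortKey_injective _ _ (congrFun (Tuple.unique_monotone m1 m2) i)]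
  · intro w hw
    simp only [Finset.coe_filter, Fintype.mem_piFinset, Set.mem_ofPred_eq, Finset.mem_filter] at hw
    obtain ⟨⟨-, hc⟩, hl⟩ := hw
    set σ := Tuple.sort (sortKey s w) with hσ
    have hmono : StrictMono (sortKey s w ∘ σ) :=
      (Tuple.monotone_sort (sortKey s w)).strictMono_of_injective
        ((sortKey_injective s w).comp σ.injective)
    have hws : (fun i => w (σ i)) = s := by
      refine eq_of_monotone_of_content_eq (monotone_iff_forall_lt.2 fun i j hij => ?_) hs
        ((content_comp_perm w σ).trans hc)
      have hlt : (if w (σ j) < s (σ j) then n else 0) + (n - 1 - (σ j : ℕ)) < 2 * n := by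
        split_ifs <;> omega
      rcases lt_or_eq_and_lt_of_mul_add_lt hlt (hmono hij) with h | h
      · exact h.le
      · exact h.1.le
    have hexc : ∀ i, i < σ i ↔ s i < s (σ i) := by
      refine fun i => ⟨fun hi => (hs hi.le).lt_of_ne fun h => ?_, fun h => ?_⟩
      · exact hl (σ i) ((congrFun hws i).trans h) i hi h
      · by_contra hi
        exact h.not_ge (hs (not_lt.1 hi))
    refine ⟨σ, ?_, ?_⟩
    · rw [Finset.mem_coe, Finset.mem_filter]
      refine ⟨Finset.mem_univ _, ?_⟩
      have : sortKey s w ∘ σ = _ := funext (sortKey_apply (congrFun hws) hexc)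
      rw [this] at hmono
      exact hmono
    · funext j
      change s (σ.symm j) = w j
      rw [← congrFun hws, Equiv.apply_symm_apply]
  · intro σ hσ
    have hc : Compat s σ := (Finset.mem_filter.1 hσ).2
    congr 1
    refine Finset.card_bij (fun i _ => σ i) ?_ (fun _ _ _ _ h => σ.injective h) ?_
    · intro i hi
      rw [Finset.mem_filter] at hi ⊢
      refine ⟨Finset.mem_univ _, ?_⟩
      change s (σ.symm (σ i)) < s (σ i)
      rw [Equiv.symm_apply_apply]
      exact (hc.lt_apply_iff i).1 hi.2
    · intro j hj
      refine ⟨σ.symm j, ?_, σ.apply_symm_apply j⟩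
      rw [Finset.mem_filter] at hj ⊢
      refine ⟨Finset.mem_univ _, (hc.lt_apply_iff _).2 ?_⟩
      rw [Equiv.apply_symm_apply]
      exact hj.2

end

/-- The generating function of balanced families of arcs as a sum over permutations. -/
lemma balancedSum_eq_sum_perm (t : ℝ) {B M : ℕ} (hM : M ≤ B) (x : ℕ → ℝ) (n : ℕ) :
    open Classical in
    balancedSum t B x M n = ∑ σ : Equiv.Perm (Fin n),
      t ^ (Finset.univ.filter fun i => i < σ i).card *
        ∑ s ∈ (Fintype.piFinset fun _ : Fin n => Finset.range M).filter (Compat · σ),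
          ∏ i, x (s i) := by
  classical
  rw [balancedSum, sum_finsuppAntidiag_eq_sum_monotone]
  have : ∀ s ∈ (Fintype.piFinset fun _ : Fin n => Finset.range M).filter Monotone,
      monomialWeight x (content s) * (arrayPoly t B (content s)).coeff (content s) =
        ∑ σ : Equiv.Perm (Fin n), if Compat s σ then
          t ^ (Finset.univ.filter fun i => i < σ i).card * ∏ i, x (s i) else 0 := by
    intro s hs
    rw [Finset.mem_filter, Fintype.mem_piFinset] at hs
    have hB : ∀ i, s i < B := fun i => (Finset.mem_range.1 (hs.1 i)).trans_le hM
    rw [monomialWeight_content, coeff_arrayPoly_content s hB, ← sum_compat_eq_sum_words t hs.2 hB,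
      Finset.mul_sum]
    refine Finset.sum_congr rfl fun σ _ => ?_
    split_ifs
    · rw [mul_comm]
    · rw [mul_zero]
  rw [Finset.sum_congr rfl this, Finset.sum_comm]
  refine Finset.sum_congr rfl fun σ _ => ?_
  rw [Finset.mul_sum, ← Finset.sum_filter, Finset.filter_filter]
  refine Finset.sum_congr (Finset.filter_congr fun s _ => ?_) fun _ _ => rfl
  exact ⟨fun h => h.2, fun h => ⟨h.monotone, h⟩⟩

/-- The sequences below `M` that increase by at least `N j` at step `j`. -/
def chains (N : ℕ → ℕ) (n M : ℕ) : Finset (Fin n → ℕ) :=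
  (Fintype.piFinset fun _ => Finset.range M).filter fun s =>
    ∀ i j : Fin n, i < j → s i + N j ≤ s j

/-- The generating function of `chains N n M`. -/
noncomputable def chainSum (q : ℝ) (N : ℕ → ℕ) (n M : ℕ) : ℝ :=
  ∑ s ∈ chains N n M, ∏ i, q ^ (M - 1 - s i)

section

variable {q : ℝ} {N : ℕ → ℕ}

lemma chainSum_zero (M : ℕ) : chainSum q N 0 M = 1 := by
  simp [chainSum, chains]

lemma snoc_mem_chains_iff {n M m : ℕ} {s : Fin n → ℕ} :
    (Fin.snoc s m : Fin (n + 1) → ℕ) ∈ chains N (n + 1) M ↔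
      m < M ∧ s ∈ chains N n (m + 1 - N n) := by
  simp only [chains, Finset.mem_filter, Fintype.mem_piFinset, Finset.mem_range, Fin.forall_fin_succ',
    Fin.snoc_castSucc, Fin.snoc_last, Fin.castSucc_lt_castSucc_iff, Fin.val_castSucc, Fin.val_last,
    lt_irrefl, (Fin.le_last _).not_gt, Fin.castSucc_lt_last, true_imp_iff, false_imp_iff, and_true,
    implies_true, forall_and]
  constructor
  · rintro ⟨⟨h1, h2⟩, h3, h4⟩
    exact ⟨h2, fun i => by have := h4 i; omega, h3⟩
  · rintro ⟨h1, h2, h3⟩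
    exact ⟨⟨fun i => by have := h2 i; omega, h1⟩, h3, fun i => by have := h2 i; omega⟩

lemma chainSum_succ_eq_sum (hN : ∀ j, N j ≤ 1) (n M : ℕ) :
    chainSum q N (n + 1) M = q ^ (n * N n) * ∑ k ∈ Finset.range M,
      q ^ ((n + 1) * k) * chainSum q N n (M - k - N n) := by
  have h1 : chainSum q N (n + 1) M = ∑ p ∈ (Finset.range M).sigma fun m => chains N n (m + 1 - N n),
      q ^ (M - 1 - p.1) * ∏ i, q ^ (M - 1 - p.2 i) := by
    symm
    refine Finset.sum_bij (fun p _ => (Fin.snoc p.2 p.1 : Fin (n + 1) → ℕ)) ?_ ?_ ?_ ?_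
    · rintro ⟨m, s⟩ h
      rw [Finset.mem_sigma, Finset.mem_range] at h
      exact snoc_mem_chains_iff.2 h
    · rintro ⟨m, s⟩ _ ⟨m', s'⟩ _ h
      obtain ⟨rfl, rfl⟩ := Fin.snoc_inj.1 h
      rfl
    · intro s hs
      refine ⟨⟨s (Fin.last n), Fin.init s⟩, ?_, Fin.snoc_init_self s⟩
      rw [Finset.mem_sigma, Finset.mem_range]
      rw [← Fin.snoc_init_self s] at hs
      exact snoc_mem_chains_iff.1 hs
    · rintro ⟨m, s⟩ _
      rw [Fin.prod_univ_castSucc]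
      simp [mul_comm]
  rw [h1, Finset.sum_sigma, ← Finset.sum_range_reflect, Finset.mul_sum]
  refine Finset.sum_congr rfl fun k hk => ?_
  rw [Finset.mem_range] at hk
  have h2 : M - 1 - k + 1 - N n = M - k - N n := by omega
  have h3 := hN n
  simp only
  rw [h2, chainSum, Finset.mul_sum, Finset.mul_sum]
  refine Finset.sum_congr rfl fun s hs => ?_
  have h4 : ∀ i, q ^ (M - 1 - s i) = q ^ (k + N n) * q ^ (M - k - N n - 1 - s i) := by
    intro i
    rw [← pow_add]
    have := Finset.mem_range.1 (Fintype.mem_piFinset.1 (Finset.mem_filter.1 hs).1 i)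
    congr 1
    omega
  simp only [h4]
  rw [Finset.prod_mul_distrib, Finset.prod_const, Finset.card_univ, Fintype.card_fin, ← pow_mul,
    ← mul_assoc, ← pow_add, ← mul_assoc, ← pow_add]
  congr 2
  have : M - 1 - (M - 1 - k) = k := by omega
  rw [this]
  ring

lemma chainSum_succ_succ (hN : ∀ j, N j ≤ 1) (n M : ℕ) :
    chainSum q N (n + 1) (M + 1) =
      q ^ (n + 1) * chainSum q N (n + 1) M + q ^ (n * N n) * chainSum q N n (M + 1 - N n) := by
  rw [chainSum_succ_eq_sum hN, Finset.sum_range_succ', chainSum_succ_eq_sum hN, mul_add,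
    mul_left_comm (q ^ (n + 1)), Finset.mul_sum _ _ (q ^ (n + 1))]
  congr 2
  · refine Finset.sum_congr rfl fun k _ => ?_
    rw [Nat.add_sub_add_right]
    ring
  · simp

lemma tendsto_of_eq_mul_add {r c : ℝ} (h0 : 0 ≤ r) (h1 : r < 1) {a b : ℕ → ℝ}
    (h : ∀ M, a (M + 1) = r * a M + b M) (hb : Filter.Tendsto b Filter.atTop (nhds c)) :
    Filter.Tendsto a Filter.atTop (nhds (c / (1 - r))) := by
  have hr' : 0 < 1 - r := by linarith
  have hr : 1 - r ≠ 0 := hr'.ne'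
  rw [Metric.tendsto_atTop] at hb ⊢
  set A := c / (1 - r) with hA
  have hA' : c = A * (1 - r) := by rw [hA, div_mul_cancel₀ _ hr]
  intro ε hε
  obtain ⟨M₀, hM₀⟩ := hb (ε / 2 * (1 - r)) (by positivity)
  have key : ∀ k, |a (M₀ + k) - A| ≤ r ^ k * |a M₀ - A| + ε / 2 := by
    intro k
    induction k with
    | zero => simp; linarith
    | succ k ih =>
      have e : a (M₀ + (k + 1)) - A = r * (a (M₀ + k) - A) + (b (M₀ + k) - c) := by
        rw [← add_assoc, h, hA']; ring
      have hb' := (hM₀ (M₀ + k) (by omega)).le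
      rw [Real.dist_eq] at hb'
      calc |a (M₀ + (k + 1)) - A| ≤ |r * (a (M₀ + k) - A)| + |b (M₀ + k) - c| := by
            rw [e]; exact abs_add_le _ _
        _ ≤ r * (r ^ k * |a M₀ - A| + ε / 2) + ε / 2 * (1 - r) := by
            rw [abs_mul, abs_of_nonneg h0]
            gcongr
        _ = r ^ (k + 1) * |a M₀ - A| + ε / 2 := by ring
  have hz : Filter.Tendsto (fun k : ℕ => r ^ k * |a M₀ - A|) Filter.atTop (nhds 0) := by
    simpa using (tendsto_pow_atTop_nhds_zero_of_lt_one h0 h1).mul_const |a M₀ - A|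
  obtain ⟨K, hK⟩ := (hz.eventually (gt_mem_nhds (half_pos hε))).exists_forall_of_atTop
  refine ⟨M₀ + K, fun M hM => ?_⟩
  have h3 := key (M - M₀)
  have h4 := hK (M - M₀) (by omega)
  rw [Nat.add_sub_cancel' (by omega)] at h3
  rw [Real.dist_eq]
  linarith

lemma tendsto_chainSum (h0 : 0 < q) (h1 : q < 1) (hN : ∀ j, N j ≤ 1) (n : ℕ) :
    Filter.Tendsto (chainSum q N n) Filter.atTop
      (nhds (q ^ (∑ j ∈ Finset.range n, j * N j) / ∏ k ∈ Finset.range n, (1 - q ^ (k + 1)))) := by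
  induction n with
  | zero =>
    have : chainSum q N 0 = fun _ => 1 := funext chainSum_zero
    simp [this]
  | succ n ih =>
    have h := tendsto_of_eq_mul_add (by positivity) (pow_lt_one₀ h0.le h1 n.succ_ne_zero)
      (chainSum_succ_succ hN n)
      (((ih.comp (Filter.tendsto_atTop_mono (fun M => (by have := hN n; omega : M ≤ M + 1 - N n))
        Filter.tendsto_id))).const_mul (q ^ (n * N n)))
    convert h using 2
    rw [Finset.sum_range_succ, Finset.prod_range_succ, pow_add]
    field_simp

end

/-- The indicator of the descents of `excKey σ`. -/
def keyDescent {n : ℕ} (σ : Equiv.Perm (Fin n)) (j : ℕ) : ℕ :=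
  if h : 0 < j ∧ j < n then if excKey σ ⟨j, h.2⟩ < excKey σ ⟨j - 1, by omega⟩ then 1 else 0 else 0

lemma keyDescent_le_one {n : ℕ} (σ : Equiv.Perm (Fin n)) (j : ℕ) : keyDescent σ j ≤ 1 := by
  rw [keyDescent]
  split_ifs <;> omega

lemma keyDescent_succ {n : ℕ} (σ : Equiv.Perm (Fin n)) {j : ℕ} (h : j + 1 < n) :
    keyDescent σ (j + 1) = if excKey σ ⟨j + 1, h⟩ < excKey σ ⟨j, by omega⟩ then 1 else 0 := by
  rw [keyDescent, dif_pos ⟨j.succ_pos, h⟩]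
  rfl

lemma excKey_injective {n : ℕ} (σ : Equiv.Perm (Fin n)) : Function.Injective (excKey σ) := by
  intro i j h
  rw [excKey, excKey] at h
  apply σ.injective
  rw [Fin.ext_iff]
  split_ifs at h <;> omega

lemma compat_iff {n : ℕ} {s : Fin n → ℕ} {σ : Equiv.Perm (Fin n)} :
    Compat s σ ↔ ∀ i j : Fin n, i < j → s i + keyDescent σ j ≤ s j := by
  constructor
  · rintro hc ⟨i, hi⟩ ⟨j, hj⟩ hij
    rw [Fin.mk_lt_mk] at hij
    obtain ⟨k, rfl⟩ := Nat.exists_eq_add_of_lt hij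
    have h1 := hc.monotone (show (⟨i, hi⟩ : Fin n) ≤ ⟨i + k, by omega⟩ from by simp)
    have hlt : (⟨i + k, by omega⟩ : Fin n) < ⟨i + k + 1, hj⟩ := by simp
    have h2 := hc.monotone hlt.le
    rw [keyDescent_succ σ hj]
    split_ifs with h
    · rcases lt_or_eq_and_lt_of_mul_add_lt (excKey_lt σ _) (hc hlt) with h' | h' <;> omega
    · omega
  · intro h
    cases n with
    | zero => exact fun i => i.elim0
    | succ n =>
      refine Fin.strictMono_iff_lt_succ.2 fun i => ?_
      have h1 := h i.castSucc i.succ i.castSucc_lt_succ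
      rw [Fin.val_succ, keyDescent_succ σ (by omega)] at h1
      have h2 : (⟨i, by omega⟩ : Fin (n + 1)) = i.castSucc := rfl
      have h3 : (⟨i + 1, by omega⟩ : Fin (n + 1)) = i.succ := rfl
      rw [h2, h3] at h1
      split_ifs at h1 with h4
      · exact mul_add_lt_of_lt (excKey_lt σ _) h1
      · have h5 : excKey σ i.castSucc < excKey σ i.succ :=
          (not_lt.1 h4).lt_of_ne ((excKey_injective σ).ne i.castSucc_lt_succ.ne)
        have h6 : 2 * (n + 1) * s i.castSucc ≤ 2 * (n + 1) * s i.succ :=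
          Nat.mul_le_mul_left _ h1
        omega

lemma balancedSum_eq_sum_chainSum (t q : ℝ) {B M : ℕ} (hM : M ≤ B) (n : ℕ) :
    balancedSum t B (fun b => q ^ (M - 1 - b)) M n = ∑ σ : Equiv.Perm (Fin n),
      t ^ (Finset.univ.filter fun i => i < σ i).card * chainSum q (keyDescent σ) n M := by
  classical
  rw [balancedSum_eq_sum_perm t hM]
  refine Finset.sum_congr rfl fun σ _ => ?_
  rw [chainSum, chains]
  simp only [compat_iff]

lemma balancedSum_scale (t q : ℝ) (B : ℕ) (x : ℕ → ℝ) {y : ℕ → ℝ} {M : ℕ}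
    (h : ∀ b < M, y b = q * x b) (n : ℕ) :
    balancedSum t B y M n = q ^ n * balancedSum t B x M n := by
  rw [balancedSum, balancedSum, Finset.mul_sum]
  refine Finset.sum_congr rfl fun d hd => ?_
  rw [Finset.mem_finsuppAntidiag] at hd
  rw [← mul_assoc, monomialWeight, monomialWeight, Finsupp.prod_of_support_subset _ hd.2 _ (by simp),
    Finsupp.prod_of_support_subset _ hd.2 _ (by simp), ← hd.1, ← Finset.prod_pow_eq_pow_sum,
    ← Finset.prod_mul_distrib]
  congr 1
  refine Finset.prod_congr rfl fun b hb => ?_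
  rw [h b (Finset.mem_range.1 hb), mul_pow]

/-- The sum of `chainSum` over permutations, weighted by excedances. -/
noncomputable def permChainSum (t q : ℝ) (M n : ℕ) : ℝ :=
  ∑ σ : Equiv.Perm (Fin n),
    t ^ (Finset.univ.filter fun i => i < σ i).card * chainSum q (keyDescent σ) n M

lemma permChainSum_zero (t q : ℝ) (M : ℕ) : permChainSum t q M 0 = 1 := by
  simp [permChainSum, chainSum_zero]

lemma permChainSum_succ_succ (t q : ℝ) (M n : ℕ) :
    permChainSum t q (M + 1) (n + 1) = q ^ (n + 1) * permChainSum t q M (n + 1) +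
      (t * (∑ p ∈ Finset.HasAntidiagonal.antidiagonal n, if p.2 = 0 then 0 else
        permChainSum t q (M + 1) p.1 * (q ^ p.2 * permChainSum t q M p.2)) +
          q ^ n * permChainSum t q M n) := by
  have h1 : ∀ k, balancedSum t (M + 1) (fun b => q ^ (M - b)) (M + 1) k =
      permChainSum t q (M + 1) k := fun k => balancedSum_eq_sum_chainSum t q le_rfl k
  have h2 : ∀ k, balancedSum t (M + 1) (fun b => q ^ (M - b)) M k =
      q ^ k * permChainSum t q M k := by
    intro k
    rw [permChainSum, ← balancedSum_eq_sum_chainSum t q M.le_succ k]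
    refine balancedSum_scale t q _ _ (fun b hb => ?_) k
    rw [← pow_succ']
    congr 1
    omega
  have h := congrArg (PowerSeries.coeff (n + 1))
    (balancedSeries_succ (t := t) (fun b => q ^ (M - b)) M.lt_succ_self)
  rw [map_add, mul_assoc, PowerSeries.coeff_succ_X_mul, PowerSeries.coeff_C_mul, map_add,
    PowerSeries.coeff_C_mul, PowerSeries.coeff_mul] at h
  simp only [balancedSeries, PowerSeries.coeff_mk, map_sub, h1, h2, PowerSeries.coeff_one,
    Nat.sub_self, pow_zero, one_mul] at h
  rw [h]
  congr 3
  refine Finset.sum_congr rfl fun p _ => ?_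
  split_ifs with hp
  · rw [hp, permChainSum_zero, pow_zero, one_mul, sub_self, mul_zero]
  · rw [sub_zero]

/-- The limit of `permChainSum`. -/
noncomputable def permLimit (t q : ℝ) (n : ℕ) : ℝ :=
  (∑ σ : Equiv.Perm (Fin n), t ^ (Finset.univ.filter fun i => i < σ i).card *
    q ^ (∑ j ∈ Finset.range n, j * keyDescent σ j)) / ∏ k ∈ Finset.range n, (1 - q ^ (k + 1))

section

variable {t q : ℝ}

lemma tendsto_permChainSum (h0 : 0 < q) (h1 : q < 1) (n : ℕ) :
    Filter.Tendsto (fun M => permChainSum t q M n) Filter.atTop (nhds (permLimit t q n)) := by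
  rw [permLimit, Finset.sum_div]
  refine tendsto_finsetSum _ fun σ _ => ?_
  rw [mul_div_assoc]
  exact (tendsto_chainSum h0 h1 (keyDescent_le_one σ) n).const_mul _

lemma permLimit_zero : permLimit t q 0 = 1 := by
  simp [permLimit]

lemma permLimit_succ (h0 : 0 < q) (h1 : q < 1) (n : ℕ) :
    permLimit t q (n + 1) = q ^ (n + 1) * permLimit t q (n + 1) +
      (t * (∑ p ∈ Finset.HasAntidiagonal.antidiagonal n, if p.2 = 0 then 0 else
        permLimit t q p.1 * (q ^ p.2 * permLimit t q p.2)) + q ^ n * permLimit t q n) := by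
  have hl := tendsto_permChainSum (t := t) h0 h1
  have hl' : ∀ k, Filter.Tendsto (fun M => permChainSum t q (M + 1) k) Filter.atTop
      (nhds (permLimit t q k)) := fun k => (hl k).comp (Filter.tendsto_add_atTop_nat 1)
  refine tendsto_nhds_unique (hl' (n + 1)) ?_
  simp only [permChainSum_succ_succ]
  refine ((hl (n + 1)).const_mul _).add (((tendsto_finsetSum _ fun p _ => ?_).const_mul t).add
    ((hl n).const_mul _))
  split_ifs
  · exact tendsto_const_nhds
  · exact (hl' p.1).mul ((hl p.2).const_mul _)

lemma sum_pow_listAi (h0 : 0 < q) (h1 : q < 1) (V : Finset ℕ) :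
    ∑ l ∈ orderings V, q⁻¹ ^ listAi l * t ^ listDes l =
      powSubOneProd q⁻¹ V.card * (q ^ V.card * permLimit t q V.card) := by
  have hq := h0.ne'
  refine sum_orderings_pow (h := fun n => q ^ n * permLimit t q n) ((one_lt_inv₀ h0).2 h1)
    (by simp [permLimit_zero]) (fun n => ?_) V
  have h2 : q ^ (n + 1) * permLimit t q (n + 1) * (q⁻¹ ^ (n + 1) - 1) =
      permLimit t q (n + 1) - q ^ (n + 1) * permLimit t q (n + 1) := by
    have : q ^ (n + 1) * q⁻¹ ^ (n + 1) = 1 := by rw [← mul_pow, mul_inv_cancel₀ hq, one_pow]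
    linear_combination permLimit t q (n + 1) * this
  have h3 : ∀ p : ℕ × ℕ, q⁻¹ ^ p.1 * (q ^ p.1 * permLimit t q p.1) = permLimit t q p.1 := by
    intro p
    rw [← mul_assoc, ← mul_pow, inv_mul_cancel₀ hq, one_pow, one_mul]
  simp only [h2, h3]
  linear_combination permLimit_succ (t := t) h0 h1 n

lemma powSubOneProd_inv_mul (h0 : 0 < q) (h1 : q < 1) (n : ℕ) :
    powSubOneProd q⁻¹ n * (q ^ n * permLimit t q n) =
      q⁻¹ ^ (∑ k ∈ Finset.range n, k) *
        ∑ σ : Equiv.Perm (Fin n), t ^ (Finset.univ.filter fun i => i < σ i).card *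
          q ^ (∑ j ∈ Finset.range n, j * keyDescent σ j) := by
  have hq := h0.ne'
  have h2 : powSubOneProd q⁻¹ n * q ^ n =
      q⁻¹ ^ (∑ k ∈ Finset.range n, k) * ∏ k ∈ Finset.range n, (1 - q ^ (k + 1)) := by
    have h3 : q ^ n = ∏ _k ∈ Finset.range n, q := by simp
    rw [powSubOneProd, ← Finset.prod_pow_eq_pow_sum, ← Finset.prod_mul_distrib, h3,
      ← Finset.prod_mul_distrib]
    refine Finset.prod_congr rfl fun k _ => ?_
    rw [pow_succ, pow_succ, inv_pow]
    field_simp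
  have h4 : ∏ k ∈ Finset.range n, (1 - q ^ (k + 1)) ≠ 0 :=
    Finset.prod_ne_zero_iff.2 fun k _ => (sub_pos.2 (pow_lt_one₀ h0.le h1 k.succ_ne_zero)).ne'
  rw [← mul_assoc, h2, permLimit, mul_assoc, mul_div_cancel₀ _ h4]

end

lemma exc_eq_card_filter {n : ℕ} (σ : Equiv.Perm (Fin n)) :
    exc σ = ∑ i ∈ Finset.range (n - 1), if i + 1 < pv σ (i + 1) then 1 else 0 := by
  rw [exc, ExcSet, Finset.card_filter, sum_Icc_one_eq_sum_range]

lemma maj_eq_sum_range {n : ℕ} (σ : Equiv.Perm (Fin n)) :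
    maj σ = ∑ i ∈ Finset.range (n - 1),
      (i + 1) * if pv σ (i + 2) < pv σ (i + 1) then 1 else 0 := by
  rw [maj, DesSet, Finset.sum_filter, sum_Icc_one_eq_sum_range]
  simp

lemma card_filter_lt_apply {n : ℕ} (σ : Equiv.Perm (Fin n)) :
    (Finset.univ.filter fun i => i < σ i).card = exc σ := by
  rw [exc_eq_card_filter, Finset.card_filter]
  cases n with
  | zero => simp
  | succ n =>
    rw [Fin.sum_univ_castSucc, if_neg (Fin.le_last _).not_gt, add_zero,
      ← Fin.sum_univ_eq_sum_range (fun i => if i + 1 < pv σ (i + 1) then 1 else 0)]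
    refine Finset.sum_congr rfl fun i _ => if_congr ?_ rfl rfl
    have := pv_succ σ i.castSucc
    rw [Fin.val_castSucc] at this
    rw [this, Fin.lt_def, Fin.val_castSucc]
    omega

lemma keyDescent_add {n : ℕ} (σ : Equiv.Perm (Fin n)) {i : ℕ} (h : i + 1 < n) :
    keyDescent σ (i + 1) + (if pv σ (i + 2) < pv σ (i + 1) then 1 else 0) +
        (if i + 2 < pv σ (i + 2) then 1 else 0) =
      1 + if i + 1 < pv σ (i + 1) then 1 else 0 := by
  have h1 : pv σ (i + 1) = σ ⟨i, by omega⟩ + 1 := pv_succ σ ⟨i, by omega⟩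
  have h2 : pv σ (i + 2) = σ ⟨i + 1, h⟩ + 1 := pv_succ σ ⟨i + 1, h⟩
  have hne : (σ ⟨i, by omega⟩ : ℕ) ≠ σ ⟨i + 1, h⟩ := by
    intro e
    have := σ.injective (Fin.ext e)
    simp at this
  rw [keyDescent_succ σ h, h1, h2, excKey, excKey]
  simp only [Fin.lt_def]
  have := (σ ⟨i, by omega⟩).isLt
  have := (σ ⟨i + 1, h⟩).isLt
  generalize (σ ⟨i, by omega⟩ : ℕ) = a at *
  generalize (σ ⟨i + 1, h⟩ : ℕ) = b at *
  split_ifs <;> omega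

lemma sum_keyDescent_add_maj {n : ℕ} (σ : Equiv.Perm (Fin n)) :
    ∑ j ∈ Finset.range n, j * keyDescent σ j + maj σ = ∑ k ∈ Finset.range n, k + exc σ := by
  cases n with
  | zero => simp [maj, DesSet, exc, ExcSet]
  | succ n =>
    rw [Finset.sum_range_succ', Finset.sum_range_succ' _ n, maj_eq_sum_range, exc_eq_card_filter,
      Nat.add_sub_cancel, zero_mul, add_zero, add_zero]
    have key : ∀ m ≤ n, ∑ j ∈ Finset.range m, (j + 1) * keyDescent σ (j + 1) +
        ∑ i ∈ Finset.range m, (i + 1) * (if pv σ (i + 2) < pv σ (i + 1) then 1 else 0) +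
          m * (if m + 1 < pv σ (m + 1) then 1 else 0) =
        ∑ k ∈ Finset.range m, (k + 1) +
          ∑ i ∈ Finset.range m, if i + 1 < pv σ (i + 1) then 1 else 0 := by
      intro m
      induction m with
      | zero => simp
      | succ m ih =>
        intro hm
        have h1 := ih (by omega)
        have h2 := keyDescent_add σ (i := m) (by omega)
        simp only [Finset.sum_range_succ]
        linear_combination h1 + (m + 1) * h2
    have h := key n le_rfl
    have h1 : pv σ (n + 1) = σ (Fin.last n) + 1 := pv_succ σ (Fin.last n)
    rwa [if_neg (by rw [h1]; omega), mul_zero, add_zero] at h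

lemma sum_pow_aid_eq {r : ℝ} (hr : 1 < r) (t : ℝ) (n : ℕ) :
    ∑ σ : Equiv.Perm (Fin n), r ^ aid σ * t ^ desStat σ =
      ∑ σ : Equiv.Perm (Fin n), r ^ maj σ * t ^ exc σ := by
  have hr0 : 0 < r := one_pos.trans hr
  have h1 : ∑ σ : Equiv.Perm (Fin n), r ^ aid σ * t ^ desStat σ =
      ∑ l ∈ orderings (Finset.Icc 1 n), r ^ listAi l * (t * r) ^ listDes l := by
    rw [← sum_perm_eq_sum_orderings]
    refine Finset.sum_congr rfl fun σ _ => ?_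
    rw [← aiStat_eq_listAi, ← desStat_eq_listDes, aid, pow_add, mul_pow]
    ring
  have h2 := sum_pow_listAi (t := t * r) (inv_pos.2 hr0) (inv_lt_one_of_one_lt₀ hr)
    (Finset.Icc 1 n)
  rw [powSubOneProd_inv_mul (inv_pos.2 hr0) (inv_lt_one_of_one_lt₀ hr), inv_inv, Nat.card_Icc,
    Nat.add_sub_cancel] at h2
  rw [h1, h2, Finset.mul_sum]
  refine Finset.sum_congr rfl fun σ _ => ?_
  have h3 := congrArg (r ^ ·) (sum_keyDescent_add_maj σ)
  simp only [pow_add] at h3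
  rw [card_filter_lt_apply, mul_pow, inv_pow]
  field_simp
  linear_combination -(t ^ exc σ) * h3

open MvPolynomial in
theorem aid_des_equidistributed_with_maj_exc (n : ℕ) (hn : 1 ≤ n) :
    ∑ σ : Equiv.Perm (Fin n),
        (X 0 : MvPolynomial (Fin 2) ℤ) ^ aid σ * (X 1 : MvPolynomial (Fin 2) ℤ) ^ desStat σ =
      ∑ σ : Equiv.Perm (Fin n),
        (X 0 : MvPolynomial (Fin 2) ℤ) ^ maj σ * (X 1 : MvPolynomial (Fin 2) ℤ) ^ exc σ := by
  apply MvPolynomial.map_injective (Int.castRingHom ℝ) Int.cast_injective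
  refine MvPolynomial.funext_set (s := ![Set.Ioi 1, Set.univ]) ?_ ?_
  · intro i
    fin_cases i
    · exact Set.Ioi_infinite 1
    · exact Set.infinite_univ
  · intro x hx
    have hr : 1 < x 0 := hx 0 (Set.mem_univ _)
    simpa using sum_pow_aid_eq hr (x 1) n
end

section
/- For every permutation σ of [n]={1,…,n}, the following formal power series identity in q holds: Π_{k=1}^{n} (1 − q^k) · Σ q^{(i_1−1)+(i_2−1)+⋯+(i_n−1)} = q^{maj(σ) − exc(σ)}, where the sum is over all sequences of positive integers i_1 ≥ i_2 ≥ ⋯ ≥ i_n such that i_j > i_{j+1} whenever j ∈ Exd(σ). (That is, F_{Exd(σ),n}(1,q,q²,…) = q^{maj(σ)−exc(σ)} / ((1−q)(1−q²)⋯(1−q^n)).) -/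
/-!
STATEMENT 4: For every permutation σ of [n],
(Π_{k=1}^n (1 − q^k)) · F_{Exd(σ),n}(1,q,q²,…) = q^{maj(σ)−exc(σ)}
as formal power series in q, where F_{S,n}(1,q,q²,…) is the principal specialization
x_i := q^{i−1} of the fundamental quasisymmetric function.
-/

open scoped Classical

/-- The excedance-descent set `Exd(σ) ⊆ [n-1]`: `i ∈ Exd(σ)` iff
(σ(i) ≤ i and σ(i+1) > i+1), or (σ(i) > i and σ(i+1) > i+1 and σ(i) > σ(i+1)),
or (σ(i) ≤ i and σ(i+1) ≤ i+1 and σ(i) > σ(i+1)). -/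
def ExdSet {n : ℕ} (σ : Equiv.Perm (Fin n)) : Finset ℕ :=
  (Finset.Icc 1 (n - 1)).filter fun i =>
    (pv σ i ≤ i ∧ i + 1 < pv σ (i + 1)) ∨
    (i < pv σ i ∧ i + 1 < pv σ (i + 1) ∧ pv σ (i + 1) < pv σ i) ∨
    (pv σ i ≤ i ∧ pv σ (i + 1) ≤ i + 1 ∧ pv σ (i + 1) < pv σ i)

/-- The principal specialization `F_{S,n}(1,q,q²,…)` of the fundamental quasisymmetric
function: the formal power series in `q` whose coefficient of `q^d` is the number of
sequences of positive integers `i_1 ≥ i_2 ≥ ⋯ ≥ i_n` with `i_j > i_{j+1}` whenever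
`j ∈ S`, and `(i_1−1)+⋯+(i_n−1) = d`.  (Each `i_j` is at most `d+1`, so the count is
the indicated finite cardinality; the sequence is recorded as `f : Fin n → ℕ`, with `f j`
the `(j+1)`-st entry `i_{j+1}`.) -/
noncomputable def Fspec (n : ℕ) (S : Finset ℕ) : PowerSeries ℤ :=
  PowerSeries.mk fun d =>
    (((Fintype.piFinset fun _ : Fin n => Finset.Icc 1 (d + 1)).filter fun f =>
      (∀ j : Fin n, ∀ hj : j.val + 1 < n,
        f ⟨j.val + 1, hj⟩ ≤ f j ∧ (j.val + 1 ∈ S → f ⟨j.val + 1, hj⟩ < f j)) ∧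
      (∑ j, (f j - 1)) = d).card : ℤ)

open Finset in
/-- Summation by parts for weighted differences. -/
theorem sum_Icc_mul_sub (e : ℕ → ℤ) (m : ℕ) :
    ∑ i ∈ Icc 1 m, (i : ℤ) * (e (i + 1) - e i) = m * e (m + 1) - ∑ i ∈ Icc 1 m, e i := by
  induction m with
  | zero => simp
  | succ m ih =>
    rw [sum_Icc_succ_top (by omega), sum_Icc_succ_top (by omega), ih]
    push_cast
    ring

theorem pv_ne_pv_succ {n : ℕ} (σ : Equiv.Perm (Fin n)) {i : ℕ} (h1 : 1 ≤ i) (h2 : i + 1 ≤ n) :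
    pv σ i ≠ pv σ (i + 1) := by
  unfold pv
  rw [dif_pos ⟨h1, by omega⟩, dif_pos ⟨by omega, h2⟩]
  intro h
  have h' := σ.injective (Fin.ext (Nat.succ_injective h))
  simp only [Fin.mk.injEq] at h'
  omega

theorem pv_self_le {n : ℕ} (σ : Equiv.Perm (Fin n)) : pv σ n ≤ n := by
  unfold pv
  split_ifs <;> omega

open Finset in
/-- The sum of the excedance-descent set is `maj - exc`. -/
theorem sum_ExdSet_add_exc {n : ℕ} (σ : Equiv.Perm (Fin n)) :
    ∑ i ∈ ExdSet σ, i + exc σ = maj σ := by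
  rcases Nat.eq_zero_or_pos n with rfl | hn
  · simp [ExdSet, exc, maj, DesSet, ExcSet]
  have key := sum_Icc_mul_sub (fun i => if i < pv σ i then 1 else 0) (n - 1)
  have hlast : ¬ n < pv σ n := (pv_self_le σ).not_gt
  rw [Nat.sub_add_cancel hn, if_neg hlast, mul_zero] at key
  have hE : ((∑ i ∈ ExdSet σ, i : ℕ) : ℤ) - ((∑ i ∈ DesSet σ, i : ℕ) : ℤ) =
      ∑ i ∈ Icc 1 (n - 1), (i : ℤ) *
        ((if i + 1 < pv σ (i + 1) then 1 else 0) - (if i < pv σ i then 1 else 0)) := by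
    push_cast
    rw [ExdSet, DesSet, sum_filter, sum_filter, ← sum_sub_distrib]
    refine sum_congr rfl fun i hi => ?_
    rw [mem_Icc] at hi
    have := pv_ne_pv_succ σ hi.1 (by omega)
    split_ifs <;> omega
  have hX : (exc σ : ℤ) = ∑ i ∈ Icc 1 (n - 1), if i < pv σ i then 1 else 0 := by
    rw [exc, ExcSet, sum_boole]
  rw [maj]
  omega

theorem one_sub_X_pow_mul_mk_dvd {k : ℕ} (hk : 0 < k) :
    (1 - (PowerSeries.X : PowerSeries ℤ) ^ k) *
      PowerSeries.mk (fun i => if k ∣ i then (1 : ℤ) else 0) = 1 := by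
  ext i
  rw [sub_mul, one_mul, map_sub, PowerSeries.coeff_X_pow_mul', PowerSeries.coeff_one]
  simp only [PowerSeries.coeff_mk]
  by_cases h : k ≤ i
  · rw [if_pos h, if_neg (by omega : i ≠ 0)]
    have : k ∣ i - k ↔ k ∣ i := by
      rw [← Nat.dvd_add_self_right, Nat.sub_add_cancel h]
    simp [this]
  · have : k ∣ i ↔ i = 0 :=
      ⟨fun hd => Nat.eq_zero_of_dvd_of_lt hd (by omega), fun h0 => h0 ▸ dvd_zero k⟩
    simp [h, this]

open Finset in
theorem eq_add_sum_Ico_of_step {n : ℕ} {F h : ℕ → ℕ} (hstep : ∀ k < n, F k = F (k + 1) + h k)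
    {j : ℕ} (hj : j ≤ n) : F j = F n + ∑ k ∈ Ico j n, h k := by
  induction hj using Nat.decreasingInduction with
  | self => simp
  | of_succ k hk ih =>
    rw [hstep k hk, ih, sum_eq_sum_Ico_succ_bot hk]
    omega

open Finset in
theorem sum_range_sum_Ico (n : ℕ) (h : ℕ → ℕ) :
    ∑ j ∈ range n, ∑ k ∈ Ico j n, h k = ∑ k ∈ range n, (k + 1) * h k := by
  rw [sum_comm' (t' := range n) (s' := fun k => range (k + 1))]
  · simp
  · intro a b
    simp only [mem_range, mem_Ico]
    omega

/-- Extension of a finite sequence by the value `1`. -/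
def extendOne {n : ℕ} (f : Fin n → ℕ) (k : ℕ) : ℕ := if h : k < n then f ⟨k, h⟩ else 1

open Finset in
theorem mem_filter_Fspec_iff {n : ℕ} {S : Finset ℕ} (hS : S ⊆ Icc 1 (n - 1)) (d : ℕ)
    (f : Fin n → ℕ) :
    f ∈ (Fintype.piFinset fun _ : Fin n => Icc 1 (d + 1)).filter (fun f =>
      (∀ j : Fin n, ∀ hj : j.val + 1 < n,
        f ⟨j.val + 1, hj⟩ ≤ f j ∧ (j.val + 1 ∈ S → f ⟨j.val + 1, hj⟩ < f j)) ∧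
      (∑ j, (f j - 1)) = d) ↔
    (∀ k < n, extendOne f (k + 1) + (if k + 1 ∈ S then 1 else 0) ≤ extendOne f k) ∧
      ∑ k ∈ range n, (extendOne f k - 1) = d := by
  have hsum : ∑ k ∈ range n, (extendOne f k - 1) = ∑ j, (f j - 1) := by
    rw [← Fin.sum_univ_eq_sum_range (fun k => extendOne f k - 1)]
    simp [extendOne]
  rw [hsum, mem_filter, Fintype.mem_piFinset, ← and_assoc]
  refine and_congr_left fun hd => ⟨fun ⟨hb, hm⟩ k hk => ?_, fun hm => ?_⟩
  · by_cases hk' : k + 1 < n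
    · have := hm ⟨k, hk⟩ hk'
      simp only [extendOne, hk, hk', dif_pos]
      split_ifs with h
      · exact this.2 h
      · exact this.1
    · have hkS : k + 1 ∉ S := fun h => by
        have := mem_Icc.1 (hS h)
        omega
      have := mem_Icc.1 (hb ⟨k, hk⟩)
      simpa [extendOne, hk, hk', hkS] using this.1
  · have hpos : ∀ j : Fin n, 1 ≤ f j := fun j => by
      have := eq_add_sum_Ico_of_step (F := extendOne f)
        (h := fun k => extendOne f k - extendOne f (k + 1)) (n := n)
        (fun k hk => by have := hm k hk; omega) j.isLt.le
      simp only [extendOne, j.isLt, dif_pos, lt_irrefl] at this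
      simp at this
      omega
    refine ⟨fun j => mem_Icc.2 ⟨hpos j, ?_⟩, fun j hj => ?_⟩
    · have := single_le_sum (f := fun j => f j - 1) (fun _ _ => Nat.zero_le _) (mem_univ j)
      omega
    · have := hm j j.isLt
      simp only [extendOne, j.isLt, hj, dif_pos, Fin.eta] at this
      split_ifs at this with h
      · exact ⟨by omega, fun _ => by omega⟩
      · exact ⟨this, fun h' => absurd h' h⟩

open Finset in
theorem sum_eq_sum_range_mul_ite {n : ℕ} {S : Finset ℕ} (hS : S ⊆ Icc 1 (n - 1)) :
    ∑ i ∈ S, i = ∑ k ∈ range n, (k + 1) * (if k + 1 ∈ S then 1 else 0) := by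
  simp only [mul_ite, mul_one, mul_zero]
  rw [← sum_filter]
  refine sum_bij' (fun i _ => i - 1) (fun k _ => k + 1) ?_ ?_ ?_ ?_ ?_
  · intro i hi
    have := mem_Icc.1 (hS hi)
    rw [mem_filter, mem_range, Nat.sub_add_cancel this.1]
    exact ⟨by omega, hi⟩
  · intro k hk
    exact (mem_filter.1 hk).2
  · intro i hi
    have := mem_Icc.1 (hS hi)
    omega
  · intro k _
    rfl
  · intro i hi
    have := mem_Icc.1 (hS hi)
    omega

open Finset in
theorem Fspec_eq_X_pow_mul_prod {n : ℕ} {S : Finset ℕ} (hS : S ⊆ Icc 1 (n - 1)) :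
    Fspec n S = (PowerSeries.X : PowerSeries ℤ) ^ (∑ i ∈ S, i) *
      ∏ k ∈ range n, PowerSeries.mk (fun i => if k + 1 ∣ i then (1 : ℤ) else 0) := by
  ext d
  rw [Fspec, PowerSeries.coeff_mk, PowerSeries.coeff_X_pow_mul', PowerSeries.coeff_prod]
  simp only [PowerSeries.coeff_mk, prod_ite_zero, prod_const_one, sum_boole]
  set s : ℕ → ℕ := fun k => if k + 1 ∈ S then 1 else 0 with hs
  have hSs : ∑ i ∈ S, i = ∑ k ∈ range n, (k + 1) * s k := sum_eq_sum_range_mul_ite hS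
  have hF : ∀ f : Fin n → ℕ, extendOne f n = 1 := fun f => by simp [extendOne]
  have hsum : ∀ f : Fin n → ℕ, ∀ h : ℕ → ℕ,
      (∀ k < n, extendOne f k = extendOne f (k + 1) + h k) →
      ∑ k ∈ range n, (extendOne f k - 1) = ∑ k ∈ range n, (k + 1) * h k := by
    intro f h hstep
    rw [← sum_range_sum_Ico]
    refine sum_congr rfl fun k hk => ?_
    rw [eq_add_sum_Ico_of_step hstep (mem_range.1 hk).le, hF]
    omega
  have hdiff : ∀ f : Fin n → ℕ,
      (∀ k < n, extendOne f (k + 1) + s k ≤ extendOne f k) →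
      ∑ k ∈ range n, (extendOne f k - 1) =
        ∑ k ∈ range n, (k + 1) * (extendOne f k - extendOne f (k + 1) - s k) + ∑ i ∈ S, i := by
    intro f hf
    rw [hsum f (fun k => (extendOne f k - extendOne f (k + 1) - s k) + s k)
      (fun k hk => by have := hf k hk; omega), hSs, ← sum_add_distrib]
    simp only [mul_add]
  split_ifs with hd
  swap
  · rw [Nat.cast_eq_zero, card_eq_zero, eq_empty_iff_forall_notMem]
    intro f hf
    rw [mem_filter_Fspec_iff hS] at hf
    have := hdiff f hf.1
    omega
  congr 1
  refine card_bij'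
    (fun f _ => Finsupp.onFinset (range n)
      (fun k => if k < n then (k + 1) * (extendOne f k - extendOne f (k + 1) - s k) else 0)
      (fun k hk => by
        by_contra h
        exact hk (if_neg (by simpa using h))))
    (fun l _ j => 1 + ∑ k ∈ Ico j.val n, (l k / (k + 1) + s k)) ?_ ?_ ?_ ?_
  · intro f hf
    rw [mem_filter_Fspec_iff hS] at hf
    have := hdiff f hf.1
    rw [mem_filter, mem_finsuppAntidiag]
    refine ⟨⟨?_, Finsupp.support_onFinset_subset⟩, fun k hk => ?_⟩
    · rw [sum_congr rfl (g := fun k =>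
        (k + 1) * (extendOne f k - extendOne f (k + 1) - s k))]
      · omega
      · intro k hk
        simp [mem_range.1 hk]
    · simp [mem_range.1 hk]
  · intro l hl
    rw [mem_filter, mem_finsuppAntidiag] at hl
    rw [mem_filter_Fspec_iff hS]
    have hstep : ∀ k < n,
        extendOne (fun j : Fin n => 1 + ∑ k ∈ Ico j.val n, (l k / (k + 1) + s k)) k =
        extendOne (fun j : Fin n => 1 + ∑ k ∈ Ico j.val n, (l k / (k + 1) + s k)) (k + 1) +
          (l k / (k + 1) + s k) := by
      intro k hk
      by_cases hk' : k + 1 < n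
      · simp only [extendOne, hk, hk', dif_pos]
        rw [sum_eq_sum_Ico_succ_bot hk]
        omega
      · obtain rfl : n = k + 1 := by omega
        simp [extendOne]
    refine ⟨fun k hk => ?_, ?_⟩
    · rw [hstep k hk]
      exact Nat.add_le_add_left (Nat.le_add_left _ _) _
    · rw [hsum _ _ hstep]
      simp only [mul_add, sum_add_distrib]
      rw [← hSs, sum_congr rfl (g := fun k => l k)
        fun k hk => Nat.mul_div_cancel' (hl.2 k hk), hl.1.1]
      omega
  · intro f hf
    rw [mem_filter_Fspec_iff hS] at hf
    funext j
    have := eq_add_sum_Ico_of_step (F := extendOne f)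
      (h := fun k => (extendOne f k - extendOne f (k + 1) - s k) + s k) (n := n)
      (fun k hk => by have := hf.1 k hk; simp only [hs]; omega) j.isLt.le
    rw [hF] at this
    have hj : extendOne f j = f j := by simp [extendOne]
    rw [← hj, this]
    congr 1
    refine sum_congr rfl fun k hk => ?_
    simp [(mem_Ico.1 hk).2]
  · intro l hl
    rw [mem_filter, mem_finsuppAntidiag] at hl
    ext k
    rw [Finsupp.onFinset_apply]
    split_ifs with hk
    · have hd := Nat.mul_div_cancel' (hl.2 k (mem_range.2 hk))
      have hstep : extendOne (fun j : Fin n => 1 + ∑ k ∈ Ico j.val n, (l k / (k + 1) + s k)) k =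
        extendOne (fun j : Fin n => 1 + ∑ k ∈ Ico j.val n, (l k / (k + 1) + s k)) (k + 1) +
          (l k / (k + 1) + s k) := by
        by_cases hk' : k + 1 < n
        · simp only [extendOne, hk, hk', dif_pos]
          rw [sum_eq_sum_Ico_succ_bot hk]
          omega
        · obtain rfl : n = k + 1 := by omega
          simp [extendOne]
      rw [hstep, Nat.add_sub_cancel_left, Nat.add_sub_cancel, hd]
    · by_contra h
      exact hk (mem_range.1 (hl.1.2 (Finsupp.mem_support_iff.2 (Ne.symm h))))

theorem principal_specialization_exd {n : ℕ} (σ : Equiv.Perm (Fin n)) :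
    (∏ k ∈ Finset.Icc 1 n, (1 - (PowerSeries.X : PowerSeries ℤ) ^ k)) *
        Fspec n (ExdSet σ) =
      (PowerSeries.X : PowerSeries ℤ) ^ (maj σ - exc σ) := by
  have hIcc : ∏ k ∈ Finset.Icc 1 n, (1 - (PowerSeries.X : PowerSeries ℤ) ^ k) =
      ∏ k ∈ Finset.range n, (1 - (PowerSeries.X : PowerSeries ℤ) ^ (k + 1)) := by
    rw [Finset.range_eq_Ico, Finset.prod_Ico_add'
      (fun k => 1 - (PowerSeries.X : PowerSeries ℤ) ^ k) 0 n 1]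
    rfl
  rw [hIcc, Fspec_eq_X_pow_mul_prod (S := ExdSet σ) (Finset.filter_subset _ _), mul_left_comm,
    ← Finset.prod_mul_distrib,
    Finset.prod_eq_one fun k _ => one_sub_X_pow_mul_mk_dvd k.succ_pos, mul_one]
  congr 1
  have := sum_ExdSet_add_exc σ
  omega
end
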